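/- arXiv:2605.01682 — 3 statements merged into one kernel-verified Lean document; each statement's English description precedes it below -/
import Mathlib

section
/- (Mertens product form with error term) There is a positive constant K₂ such that for all X ≥ 3, ∏_{p ≤ X} (1 - 1/p) = (e^{-γ}/log X)(1 + O(e^{-K₂ √(log X)})), where the product is over primes p ≤ X and γ is the Euler–Mascheroni constant. -/
open Finset

section LogDerivative

open Complex Metric

theorem norm_logDeriv_le_of_ne_zero {f : ℂ → ℂ} {R B : ℝ} (hR : 0 < R)
    (hf : DifferentiableOn ℂ f (ball 0 R)) (hf0 : ∀ z ∈ ball (0 : ℂ) R, f z ≠ 0)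
    (hB : ∀ z ∈ ball (0 : ℂ) R, ‖f z‖ ≤ B) {z : ℂ} (hz : ‖z‖ ≤ R / 2) :
    ‖logDeriv f z‖ ≤ 24 * (Real.log (B / ‖f 0‖) + 1) / R := by
  have h0 : (0 : ℂ) ∈ ball (0 : ℂ) R := mem_ball_self hR
  have hf0pos : 0 < ‖f 0‖ := norm_pos_iff.2 (hf0 0 h0)
  have hd : DifferentiableOn ℂ (deriv f) (ball 0 R) := hf.deriv isOpen_ball
  have hld : DifferentiableOn ℂ (fun z ↦ deriv f z / f z) (ball 0 R) := hd.div hf hf0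
  obtain ⟨g, hg⟩ := hld.isExactOn_ball
  set M := Real.log (B / ‖f 0‖) + 1 with hM
  have hB1 : 1 ≤ B / ‖f 0‖ := (one_le_div hf0pos).2 (hB 0 h0)
  have hMpos : 0 < M := by have := Real.log_nonneg hB1; linarith
  set h : ℂ → ℂ := fun z ↦ g z - g 0 with hh
  have hhd : ∀ z ∈ ball (0 : ℂ) R, HasDerivAt h (deriv f z / f z) z :=
    fun z hz ↦ (hg z hz).sub_const _
  have hconst : ∀ z ∈ ball (0 : ℂ) R, f z * exp (-h z) = f 0 := by
    have key : ∀ z ∈ ball (0 : ℂ) R, HasDerivAt (fun z ↦ f z * exp (-h z)) 0 z := by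
      intro z hz
      have h1 := (hf.differentiableAt (isOpen_ball.mem_nhds hz)).hasDerivAt.mul
        ((hhd z hz).neg.cexp)
      refine h1.congr_deriv ?_
      have := hf0 z hz
      field_simp
      ring
    intro z hz
    have := (convex_ball (0 : ℂ) R).is_const_of_fderivWithin_eq_zero (𝕜 := ℂ)
      (f := fun z ↦ f z * exp (-h z))
      (fun w hw ↦ (key w hw).differentiableAt.differentiableWithinAt)
      (fun w hw ↦ by
        rw [fderivWithin_of_isOpen isOpen_ball hw]
        ext
        simpa using (key w hw).deriv) hz h0
    simpa [hh] using this
  have hre : ∀ z ∈ ball (0 : ℂ) R, (h z).re ≤ M := by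
    intro z hz
    have h1 : f z = f 0 * exp (h z) := by
      rw [← hconst z hz, mul_assoc, ← exp_add]; simp
    have h2 : Real.exp (h z).re = ‖f z‖ / ‖f 0‖ := by
      rw [h1, norm_mul, norm_exp]; field_simp
    have h3 : (h z).re = Real.log (‖f z‖ / ‖f 0‖) := by rw [← h2, Real.log_exp]
    have : Real.log (‖f z‖ / ‖f 0‖) ≤ Real.log (B / ‖f 0‖) := by
      apply Real.log_le_log
      · have := norm_pos_iff.2 (hf0 z hz); positivity
      · gcongr; exact hB z hz
    linarith
  have hhdiff : DifferentiableOn ℂ h (ball 0 R) :=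
    fun w hw ↦ (hhd w hw).differentiableAt.differentiableWithinAt
  have hbd : ∀ w : ℂ, ‖w‖ ≤ 3 * R / 4 → ‖h w‖ ≤ 6 * M := by
    intro w hw
    have hwR : w ∈ ball (0 : ℂ) R := by rw [mem_ball_zero_iff]; linarith
    refine (borelCaratheodory_zero hMpos hhdiff hre hR hwR (by simp [hh])).trans ?_
    rw [div_le_iff₀ (by linarith)]
    nlinarith
  have hzR : z ∈ ball (0 : ℂ) R := by rw [mem_ball_zero_iff]; linarith
  have hsub : closedBall z (R / 4) ⊆ ball 0 R := by
    intro w hw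
    rw [mem_closedBall, dist_eq_norm] at hw
    rw [mem_ball_zero_iff]
    have := norm_le_norm_add_norm_sub' w z
    linarith
  have hcauchy : ‖deriv h z‖ ≤ 6 * M / (R / 4) := by
    refine norm_deriv_le_of_forall_mem_sphere_norm_le (by positivity) ?_ ?_
    · exact (hhdiff.mono hsub).diffContOnCl_ball (le_refl _)
    · intro w hw
      apply hbd
      rw [mem_sphere, dist_eq_norm] at hw
      have := norm_le_norm_add_norm_sub' w z
      linarith
  rw [(hhd z hzR).deriv] at hcauchy
  rw [logDeriv_apply]
  refine hcauchy.trans (le_of_eq ?_)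
  field_simp
  norm_num

/-- Dividing out a zero by a Blaschke factor. -/
theorem exists_blaschke_quotient {f : ℂ → ℂ} {R B : ℝ} {ρ : ℂ} (hR : 0 < R)
    (hf : Differentiable ℂ f) (hf0 : f 0 ≠ 0) (hB : ∀ z ∈ closedBall (0 : ℂ) R, ‖f z‖ ≤ B)
    (hρ : ‖ρ‖ < R) (hfρ : f ρ = 0) :
    ∃ g : ℂ → ℂ, Differentiable ℂ g ∧ (∀ z ∈ closedBall (0 : ℂ) R, ‖g z‖ ≤ B) ∧
      ‖g 0‖ = ‖f 0‖ * (R / ‖ρ‖) ∧ (∀ z ∈ ball (0 : ℂ) R, g z = 0 → f z = 0) ∧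
      (logDeriv f 0).re = (logDeriv g 0).re - ρ.re * (1 / ‖ρ‖ ^ 2 - 1 / R ^ 2) := by
  have hρ0 : ρ ≠ 0 := by rintro rfl; exact hf0 hfρ
  have hρpos : 0 < ‖ρ‖ := norm_pos_iff.2 hρ0
  have hRc : (R : ℂ) ≠ 0 := by exact_mod_cast hR.ne'
  set q := dslope f ρ with hq
  have hqd : Differentiable ℂ q := by
    rw [← differentiableOn_univ]
    exact (differentiableOn_dslope Filter.univ_mem).2 hf.differentiableOn
  have hfq : ∀ z, f z = (z - ρ) * q z := by
    intro z
    have := sub_smul_dslope f ρ z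
    rw [hfρ, sub_zero, smul_eq_mul] at this
    exact this.symm
  set b : ℂ → ℂ := fun z ↦ (R ^ 2 - (starRingEnd ℂ) ρ * z) / R with hb
  have hbd : Differentiable ℂ b := by fun_prop
  have hnormb : ∀ z : ℂ, ‖z‖ = R → ‖b z‖ = ‖z - ρ‖ := by
    intro z hz
    have hzz : (R : ℂ) ^ 2 = z * (starRingEnd ℂ) z := by
      rw [mul_conj, normSq_eq_norm_sq, hz]; norm_cast
    have : (R : ℂ) ^ 2 - (starRingEnd ℂ) ρ * z = z * (starRingEnd ℂ) (z - ρ) := by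
      rw [hzz, map_sub]; ring
    simp only [hb, this, norm_div, norm_mul, norm_conj, hz, norm_real, Real.norm_eq_abs,
      abs_of_pos hR]
    field_simp
  have hg : Differentiable ℂ fun z ↦ q z * b z := hqd.mul hbd
  refine ⟨fun z ↦ q z * b z, hg, ?_, ?_, ?_, ?_⟩
  · intro z hz
    refine norm_le_of_forall_mem_frontier_norm_le (U := ball (0 : ℂ) R) isBounded_ball
      hg.diffContOnCl ?_ (by rwa [closure_ball _ hR.ne'])
    intro w hw
    rw [frontier_ball _ hR.ne', mem_sphere_zero_iff_norm] at hw
    rw [norm_mul, hnormb w hw, mul_comm, ← norm_mul, ← hfq]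
    exact hB w (by simp [hw])
  · have h1 : ‖f 0‖ = ‖ρ‖ * ‖q 0‖ := by rw [hfq 0]; simp
    have h2 : ‖b 0‖ = R := by simp [hb, abs_of_pos hR]; field_simp
    rw [norm_mul, h1, h2]; field_simp
  · intro z hz hgz
    rw [mem_ball_zero_iff] at hz
    rcases mul_eq_zero.1 hgz with h | h
    · rw [hfq, h, mul_zero]
    · exfalso
      have h3 : (R : ℂ) ^ 2 = (starRingEnd ℂ) ρ * z := by
        simp only [hb, div_eq_zero_iff, hRc, or_false] at h
        exact sub_eq_zero.1 h
      have h4 := congrArg norm h3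
      rw [norm_mul, norm_conj, norm_pow, norm_real, Real.norm_eq_abs, abs_of_pos hR] at h4
      nlinarith [norm_nonneg z]
  · have hq0 : q 0 ≠ 0 := by
      intro h; apply hf0; rw [hfq, h, mul_zero]
    have hb0 : b 0 = R := by simp [hb]; field_simp
    have h1 : logDeriv f 0 = logDeriv (fun z : ℂ ↦ z - ρ) 0 + logDeriv q 0 := by
      rw [show f = fun z ↦ (z - ρ) * q z from funext hfq]
      exact logDeriv_mul 0 (by simpa using hρ0) hq0 (by fun_prop) (hqd 0)
    have h2 : logDeriv (fun z ↦ q z * b z) 0 = logDeriv q 0 + logDeriv b 0 :=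
      logDeriv_mul 0 hq0 (by rw [hb0]; exact hRc) (hqd 0) (hbd 0)
    have h3 : logDeriv (fun z : ℂ ↦ z - ρ) 0 = -ρ⁻¹ := by
      simp [logDeriv_apply]
    have hbder : HasDerivAt b (-(starRingEnd ℂ) ρ / R) 0 := by
      have : HasDerivAt (fun z : ℂ ↦ (R : ℂ) ^ 2 - (starRingEnd ℂ) ρ * z)
        (-((starRingEnd ℂ) ρ * 1)) 0 := ((hasDerivAt_id (0 : ℂ)).const_mul _).const_sub _
      simpa using this.div_const (R : ℂ)
    have h4 : logDeriv b 0 = -(starRingEnd ℂ) ρ / ((R ^ 2 : ℝ) : ℂ) := by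
      rw [logDeriv_apply, hbder.deriv, hb0, div_div]; push_cast; ring
    rw [h1, h2, h3, h4, add_re, add_re, neg_re, inv_re, div_ofReal_re, neg_re, conj_re,
      normSq_eq_norm_sq]
    ring

theorem neg_le_re_logDeriv_of_zeros_re_neg {R r B : ℝ} (hr : 0 < r) (hrR : r < R) (n : ℕ) :
    ∀ f : ℂ → ℂ, Differentiable ℂ f → f 0 ≠ 0 → (∀ z ∈ closedBall (0 : ℂ) R, ‖f z‖ ≤ B) →
      (∀ z ∈ ball (0 : ℂ) R, f z = 0 → z.re < 0) → B < (R / r) ^ n * ‖f 0‖ →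
      -(24 * (Real.log (B / ‖f 0‖) + 1) / r) ≤ (logDeriv f 0).re := by
  have hR : 0 < R := hr.trans hrR
  induction n with
  | zero =>
    intro f _ _ hB _ h
    have := hB 0 (by simp [hR.le])
    simp at h
    linarith
  | succ n ih =>
    intro f hf hf0 hB hz hn
    by_cases hex : ∃ ρ ∈ ball (0 : ℂ) r, f ρ = 0
    · obtain ⟨ρ, hρr, hfρ⟩ := hex
      rw [mem_ball_zero_iff] at hρr
      have hρ0 : ρ ≠ 0 := by rintro rfl; exact hf0 hfρ
      have hρpos : 0 < ‖ρ‖ := norm_pos_iff.2 hρ0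
      have hρR : ‖ρ‖ < R := hρr.trans hrR
      obtain ⟨g, hg, hgB, hg0, hgz, hgl⟩ := exists_blaschke_quotient hR hf hf0 hB hρR hfρ
      have hf0pos : 0 < ‖f 0‖ := norm_pos_iff.2 hf0
      have hle : R / r ≤ R / ‖ρ‖ := by gcongr
      have h1 : 1 ≤ R / ‖ρ‖ := (one_le_div hρpos).2 hρR.le
      have hfg : ‖f 0‖ ≤ ‖g 0‖ := by rw [hg0]; nlinarith
      have hg0' : g 0 ≠ 0 := norm_pos_iff.1 (hf0pos.trans_le hfg)
      have hBpos : 0 < B := hf0pos.trans_le (hB 0 (by simp [hR.le]))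
      have := ih g hg hg0' hgB (fun z hzz h ↦ hz z hzz (hgz z hzz h)) (by
        refine hn.trans_le ?_
        rw [hg0, pow_succ]
        have : 0 ≤ (R / r) ^ n * ‖f 0‖ := by positivity
        nlinarith)
      have hlog : Real.log (B / ‖g 0‖) ≤ Real.log (B / ‖f 0‖) := by
        apply Real.log_le_log (div_pos hBpos (hf0pos.trans_le hfg))
        gcongr
      have h2 : 24 * (Real.log (B / ‖g 0‖) + 1) / r ≤ 24 * (Real.log (B / ‖f 0‖) + 1) / r := by
        gcongr
      have h3 : ρ.re < 0 := hz ρ (by rwa [mem_ball_zero_iff]) hfρ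
      have h4 : 1 / R ^ 2 ≤ 1 / ‖ρ‖ ^ 2 := by gcongr
      rw [hgl]
      nlinarith
    · push Not at hex
      have := norm_logDeriv_le_of_ne_zero (B := B) hr hf.differentiableOn hex
        (fun z hz ↦ hB z (ball_subset_closedBall.trans (closedBall_subset_closedBall hrR.le) hz))
        (z := 0) (by simp; positivity)
      have h2 := (abs_le.1 ((abs_re_le_norm _).trans this)).1
      exact h2

/-- A lower bound for the real part of the logarithmic derivative at the centre of a disc whose
zeros all lie to the left of the centre. -/
theorem neg_le_re_logDeriv {R B : ℝ} (hR : 0 < R) {f : ℂ → ℂ} (hf : Differentiable ℂ f)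
    (hf0 : f 0 ≠ 0) (hB : ∀ z ∈ closedBall (0 : ℂ) R, ‖f z‖ ≤ B)
    (hz : ∀ z ∈ ball (0 : ℂ) R, f z = 0 → z.re < 0) :
    -(48 * (Real.log (B / ‖f 0‖) + 1) / R) ≤ (logDeriv f 0).re := by
  have hf0pos : 0 < ‖f 0‖ := norm_pos_iff.2 hf0
  obtain ⟨n, hn⟩ := pow_unbounded_of_one_lt (B / ‖f 0‖) (show (1 : ℝ) < R / (R / 2) by
    rw [lt_div_iff₀ (by positivity)]; linarith)
  have := neg_le_re_logDeriv_of_zeros_re_neg (half_pos hR) (half_lt_self hR) n f hf hf0 hB hz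
    (by rwa [div_lt_iff₀ hf0pos] at hn)
  convert this using 2
  field_simp
  ring

/-- The contribution of one zero to the lower bound `neg_le_re_logDeriv`. -/
theorem inv_sub_le_re_logDeriv {R B x : ℝ} (hx : 0 < x) (hxR : x < R) {f : ℂ → ℂ}
    (hf : Differentiable ℂ f) (hf0 : f 0 ≠ 0) (hB : ∀ z ∈ closedBall (0 : ℂ) R, ‖f z‖ ≤ B)
    (hz : ∀ z ∈ ball (0 : ℂ) R, f z = 0 → z.re < 0) (hfx : f (-x) = 0) :
    1 / x - 1 / R - 48 * (Real.log (B / ‖f 0‖) + 1) / R ≤ (logDeriv f 0).re := by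
  have hR : 0 < R := hx.trans hxR
  have hnx : ‖(-x : ℂ)‖ = x := by simp [abs_of_pos hx]
  obtain ⟨g, hg, hgB, hg0, hgz, hgl⟩ :=
    exists_blaschke_quotient (ρ := -x) hR hf hf0 hB (by rwa [hnx]) hfx
  have hf0pos : 0 < ‖f 0‖ := norm_pos_iff.2 hf0
  rw [hnx] at hg0 hgl
  have h1 : 1 ≤ R / x := (one_le_div hx).2 hxR.le
  have hfg : ‖f 0‖ ≤ ‖g 0‖ := by rw [hg0]; nlinarith
  have hg0' : g 0 ≠ 0 := norm_pos_iff.1 (hf0pos.trans_le hfg)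
  have hBpos : 0 < B := hf0pos.trans_le (hB 0 (by simp [hR.le]))
  have := neg_le_re_logDeriv hR hg hg0' hgB (fun z hzz h ↦ hz z hzz (hgz z hzz h))
  have hlog : Real.log (B / ‖g 0‖) ≤ Real.log (B / ‖f 0‖) := by
    apply Real.log_le_log (div_pos hBpos (hf0pos.trans_le hfg))
    gcongr
  have h2 : 48 * (Real.log (B / ‖g 0‖) + 1) / R ≤ 48 * (Real.log (B / ‖f 0‖) + 1) / R := by
    gcongr
  have h3 : x * (1 / x ^ 2 - 1 / R ^ 2) = 1 / x - x / R * (1 / R) := by field_simp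
  have h4 : x / R * (1 / R) ≤ 1 * (1 / R) := by gcongr; exact (div_le_one hR).2 hxR.le
  rw [hgl, neg_re, ofReal_re]
  linarith

end LogDerivative

section ZetaGrowth

open Complex Set MeasureTheory Filter Asymptotics Topology

/-- The fractional part, cut off to `(1, ∞)`. -/
noncomputable def fractTail : ℝ → ℂ := indicator (Ioi 1) fun t ↦ ((Int.fract t : ℝ) : ℂ)

theorem norm_fractTail_le (t : ℝ) : ‖fractTail t‖ ≤ 1 := by
  unfold fractTail
  by_cases h : t ∈ Ioi (1 : ℝ)
  · rw [indicator_of_mem h, norm_real, Real.norm_eq_abs, abs_of_nonneg (Int.fract_nonneg t)]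
    exact (Int.fract_lt_one t).le
  · rw [indicator_of_notMem h]; simp

theorem measurable_fractTail : Measurable fractTail :=
  (measurable_ofReal.comp measurable_fract).indicator measurableSet_Ioi

theorem locallyIntegrableOn_fractTail : LocallyIntegrableOn fractTail (Ioi 0) := by
  refine LocallyIntegrable.locallyIntegrableOn ?_ _
  refine (locallyIntegrable_const (1 : ℝ)).mono measurable_fractTail.aestronglyMeasurable ?_
  filter_upwards with t
  simpa using norm_fractTail_le t

theorem fractTail_isBigO_atTop : fractTail =O[atTop] (· ^ (-(0 : ℝ)) : ℝ → ℝ) := by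
  refine IsBigO.of_bound 1 (Eventually.of_forall fun t ↦ ?_)
  simpa using norm_fractTail_le t

theorem fractTail_isBigO_nhds_zero (b : ℝ) : fractTail =O[𝓝[>] 0] (· ^ (-b) : ℝ → ℝ) := by
  refine IsBigO.of_bound 1 ?_
  have : ∀ᶠ t : ℝ in 𝓝[>] 0, t < 1 := eventually_nhdsWithin_of_eventually_nhds
    (eventually_lt_nhds one_pos)
  filter_upwards [this] with t ht
  rw [fractTail, indicator_of_notMem (by simpa using ht.le)]
  simp

theorem mellinConvergent_fractTail {s : ℂ} (hs : s.re < 0) : MellinConvergent fractTail s :=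
  mellinConvergent_of_isBigO_rpow locallyIntegrableOn_fractTail fractTail_isBigO_atTop hs
    (fractTail_isBigO_nhds_zero (s.re - 1)) (by linarith)

theorem mellin_fractTail (s : ℂ) :
    mellin fractTail s = ∫ t in Ioi (1 : ℝ), (t : ℂ) ^ (s - 1) * ((Int.fract t : ℝ) : ℂ) := by
  have : ∀ t : ℝ, (t : ℂ) ^ (s - 1) • fractTail t =
      indicator (Ioi 1) (fun t : ℝ ↦ (t : ℂ) ^ (s - 1) * ((Int.fract t : ℝ) : ℂ)) t := by
    intro t
    by_cases h : t ∈ Ioi (1 : ℝ)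
    · rw [fractTail, indicator_of_mem h, indicator_of_mem h, smul_eq_mul]
    · rw [fractTail, indicator_of_notMem h, indicator_of_notMem h, smul_zero]
  rw [mellin]
  simp_rw [this]
  rw [setIntegral_indicator measurableSet_Ioi]
  congr 2
  ext t
  simp only [Set.mem_inter_iff, Set.mem_Ioi]
  constructor
  · exact fun h ↦ h.2
  · exact fun h ↦ ⟨by linarith, h⟩

theorem riemannZeta₁_eq_of_one_lt_re {s : ℂ} (hs : 1 < s.re) :
    riemannZeta₁ s = s - s * (s - 1) * mellin fractTail (-s) := by
  have hs1 : s - 1 ≠ 0 := by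
    intro h; rw [sub_eq_zero.1 h] at hs; simp at hs
  have h1 : riemannZeta s = s * ∫ t in Ioi (1 : ℝ), ((⌊t⌋₊ : ℂ)) * (t : ℂ) ^ (-(s + 1)) := by
    rw [← LSeries_one_eq_riemannZeta hs]
    have := LSeries_eq_mul_integral_of_nonneg (fun _ ↦ 1) zero_le_one hs (by
      refine IsBigO.of_bound 1 (Eventually.of_forall fun n ↦ ?_)
      simp) (fun _ ↦ zero_le_one)
    simpa [Pi.one_def] using this
  have hconv := mellinConvergent_fractTail (s := -s) (by rw [neg_re]; linarith)
  have hint1 : IntegrableOn (fun t : ℝ ↦ (t : ℂ) ^ (-s)) (Ioi 1) :=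
    integrableOn_Ioi_cpow_of_lt (by rw [neg_re]; linarith) one_pos
  have hint2 : IntegrableOn (fun t : ℝ ↦ (t : ℂ) ^ (-s - 1) * ((Int.fract t : ℝ) : ℂ)) (Ioi 1) := by
    refine (hconv.mono_set (Ioi_subset_Ioi zero_le_one)).congr_fun (fun t ht ↦ ?_) measurableSet_Ioi
    rw [fractTail]
    simp only [indicator_of_mem ht, smul_eq_mul]
  have h2 : ∫ t in Ioi (1 : ℝ), ((⌊t⌋₊ : ℂ)) * (t : ℂ) ^ (-(s + 1)) =
      1 / (s - 1) - mellin fractTail (-s) := by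
    have h3 : ∫ t in Ioi (1 : ℝ), (t : ℂ) ^ (-s) = 1 / (s - 1) := by
      rw [integral_Ioi_cpow_of_lt (by rw [neg_re]; linarith) one_pos]
      rw [ofReal_one, one_cpow, neg_div, ← div_neg]
      congr 1; ring
    rw [← h3, mellin_fractTail, ← integral_sub hint1 hint2]
    refine setIntegral_congr_fun measurableSet_Ioi fun t ht ↦ ?_
    have ht0 : (0 : ℝ) < t := one_pos.trans ht
    have htc : (t : ℂ) ≠ 0 := by exact_mod_cast ht0.ne'
    have h4 : (⌊t⌋₊ : ℂ) = (t : ℂ) - ((Int.fract t : ℝ) : ℂ) := by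
      rw [← ofReal_sub, Int.self_sub_fract, ← natCast_floor_eq_intCast_floor ht0.le]
      simp
    have h5 : (t : ℂ) ^ (-s) = t * (t : ℂ) ^ (-s - 1) := by
      rw [cpow_sub _ _ htc, cpow_one]; field_simp
    rw [h4, h5, show -(s + 1) = -s - 1 by ring]
    ring
  have hs1' : s ≠ 1 := sub_ne_zero.1 hs1
  have h6 : riemannZeta₁ s = (s - 1) * riemannZeta s := by
    rw [riemannZeta_eq_inv_sub_mul hs1']; field_simp
  rw [h6, h1, h2]
  field_simp

theorem riemannZeta₁_eq_of_re_pos {s : ℂ} (hs : 0 < s.re) :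
    riemannZeta₁ s = s - s * (s - 1) * mellin fractTail (-s) := by
  have hU : IsOpen {z : ℂ | 0 < z.re} := isOpen_lt continuous_const continuous_re
  have h1 : AnalyticOnNhd ℂ riemannZeta₁ {z : ℂ | 0 < z.re} :=
    differentiable_riemannZeta₁.differentiableOn.analyticOnNhd hU
  have h2 : AnalyticOnNhd ℂ (fun s ↦ s - s * (s - 1) * mellin fractTail (-s))
      {z : ℂ | 0 < z.re} := by
    refine DifferentiableOn.analyticOnNhd (fun z hz ↦ ?_) hU
    have h3 : DifferentiableAt ℂ (mellin fractTail) (-z) :=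
      mellin_differentiableAt_of_isBigO_rpow locallyIntegrableOn_fractTail fractTail_isBigO_atTop
        (by rw [neg_re]; simpa using hz) (fractTail_isBigO_nhds_zero ((-z).re - 1)) (by linarith)
    have h4 : DifferentiableAt ℂ (fun z ↦ mellin fractTail (-z)) z :=
      h3.comp z differentiableAt_id.neg
    exact (differentiableAt_id.sub ((differentiableAt_id.mul
      (differentiableAt_id.sub_const 1)).mul h4)).differentiableWithinAt
  refine h1.eqOn_of_preconnected_of_eventuallyEq h2 (convex_halfSpace_re_gt 0).isPreconnected
    (z₀ := 2) (by simp) ?_ hs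
  have : {z : ℂ | 1 < z.re} ∈ 𝓝 (2 : ℂ) :=
    (isOpen_lt continuous_const continuous_re).mem_nhds (by simp)
  filter_upwards [this] with z hz using riemannZeta₁_eq_of_one_lt_re hz

theorem norm_riemannZeta₁_le {s : ℂ} (hs : 1 / 2 ≤ s.re) :
    ‖riemannZeta₁ s‖ ≤ 3 * (1 + ‖s‖) ^ 2 := by
  have h1 : ‖mellin fractTail (-s)‖ ≤ 2 := by
    rw [mellin_fractTail]
    have hint : IntegrableOn (fun t : ℝ ↦ t ^ (-(3 / 2) : ℝ)) (Ioi 1) :=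
      integrableOn_Ioi_rpow_of_lt (by norm_num) one_pos
    have := norm_integral_le_of_norm_le hint (f := fun t : ℝ ↦
      (t : ℂ) ^ (-s - 1) * ((Int.fract t : ℝ) : ℂ)) (by
      filter_upwards [ae_restrict_mem measurableSet_Ioi] with t ht
      have ht1 : (1 : ℝ) < t := ht
      rw [norm_mul, norm_cpow_eq_rpow_re_of_pos (by linarith), norm_real, Real.norm_eq_abs,
        abs_of_nonneg (Int.fract_nonneg t)]
      calc t ^ (-s - 1).re * Int.fract t ≤ t ^ (-s - 1).re * 1 := by
            gcongr; exact (Int.fract_lt_one t).le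
        _ ≤ t ^ (-(3 / 2) : ℝ) := by
            rw [mul_one]
            apply Real.rpow_le_rpow_of_exponent_le ht1.le
            simp only [sub_re, neg_re, one_re]; linarith)
    refine this.trans (le_of_eq ?_)
    rw [integral_Ioi_rpow_of_lt (by norm_num) one_pos]
    norm_num
  rw [riemannZeta₁_eq_of_re_pos (by linarith)]
  have h2 : ‖s - 1‖ ≤ ‖s‖ + 1 := by simpa using norm_sub_le s 1
  calc ‖s - s * (s - 1) * mellin fractTail (-s)‖ ≤ ‖s‖ + ‖s‖ * ‖s - 1‖ * ‖mellin fractTail (-s)‖ := by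
        refine (norm_sub_le _ _).trans ?_
        rw [norm_mul, norm_mul]
    _ ≤ ‖s‖ + ‖s‖ * (‖s‖ + 1) * 2 := by gcongr
    _ ≤ 3 * (1 + ‖s‖) ^ 2 := by nlinarith [norm_nonneg s]

end ZetaGrowth

section ZeroFreeRegion

open Complex Metric

lemma riemannZeta₁_eq_sub_one_mul {s : ℂ} (hs : s ≠ 1) :
    riemannZeta₁ s = (s - 1) * riemannZeta s := by
  rw [riemannZeta_eq_inv_sub_mul hs, mul_inv_cancel_left₀ (sub_ne_zero.2 hs)]

lemma riemannZeta₁_ne_zero_of_one_le_re {s : ℂ} (hs : 1 ≤ s.re) : riemannZeta₁ s ≠ 0 := by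
  by_cases h : s = 1
  · simp [h]
  · rw [riemannZeta₁_eq_sub_one_mul h]
    exact mul_ne_zero (sub_ne_zero.2 h) (riemannZeta_ne_zero_of_one_le_re hs)

lemma norm_LSeries_moebius_le {s : ℂ} (hs : 1 < s.re) :
    ‖LSeries (fun n ↦ (ArithmeticFunction.moebius n : ℂ)) s‖ ≤ ‖riemannZeta s.re‖ := by
  have hs' : 1 < ((s.re : ℂ)).re := by simpa using hs
  have h1 := LSeriesHasSum_one hs'
  have h2 : HasSum (fun n ↦ ‖LSeries.term 1 (s.re : ℂ) n‖) (riemannZeta s.re).re := by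
    convert Complex.hasSum_re h1 using 2 with n
    rcases eq_or_ne n 0 with rfl | hn
    · simp
    · have hpos : (0 : ℝ) < n := by positivity
      rw [LSeries.term_of_ne_zero hn, Pi.one_apply, ← ofReal_natCast, ← ofReal_cpow hpos.le,
        ← ofReal_one, ← ofReal_div, norm_real, ofReal_re, Real.norm_of_nonneg (by positivity)]
  refine (tsum_of_norm_bounded h2 fun n ↦ ?_).trans ((le_abs_self _).trans (abs_re_le_norm _))
  rw [LSeries.norm_term_eq, LSeries.norm_term_eq]
  split_ifs with hn
  · simp
  · simp only [Pi.one_apply, norm_one, ofReal_re]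
    gcongr
    rw [norm_intCast]
    exact_mod_cast ArithmeticFunction.abs_moebius_le_one

lemma sq_div_le_norm_riemannZeta₁ {s : ℂ} (hs : 1 < s.re) (hs2 : s.re ≤ 2) :
    (s.re - 1) ^ 2 / 27 ≤ ‖riemannZeta₁ s‖ := by
  have hd : 0 < s.re - 1 := by linarith
  have hne : s ≠ 1 := fun h ↦ by simp [h] at hs
  have hne' : (s.re : ℂ) ≠ 1 := by
    intro h; have := congrArg re h; simp at this; linarith
  have h1 : riemannZeta s * LSeries (fun n ↦ (ArithmeticFunction.moebius n : ℂ)) s = 1 := by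
    rw [← LSeries_one_eq_riemannZeta hs]
    exact LSeries_one_mul_Lseries_moebius hs
  have h2 : ‖riemannZeta s.re‖ ≤ 27 / (s.re - 1) := by
    have h3 := norm_riemannZeta₁_le (s := (s.re : ℂ)) (by simp; linarith)
    rw [riemannZeta₁_eq_sub_one_mul hne', norm_mul, norm_real,
      show (s.re : ℂ) - 1 = ((s.re - 1 : ℝ) : ℂ) by push_cast; ring, norm_real,
      Real.norm_of_nonneg hd.le, Real.norm_of_nonneg (by linarith)] at h3
    rw [le_div_iff₀ hd]
    nlinarith
  have h4 : 1 ≤ ‖riemannZeta s‖ * (27 / (s.re - 1)) := by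
    calc 1 = ‖riemannZeta s‖ * ‖LSeries (fun n ↦ (ArithmeticFunction.moebius n : ℂ)) s‖ := by
          rw [← norm_mul, h1, norm_one]
      _ ≤ _ := by gcongr; exact (norm_LSeries_moebius_le hs).trans h2
  have h5 : s.re - 1 ≤ ‖s - 1‖ := by
    have := (le_abs_self _).trans (abs_re_le_norm (s - 1))
    simpa using this
  rw [riemannZeta₁_eq_sub_one_mul hne, norm_mul]
  have h6 : (s.re - 1) / 27 ≤ ‖riemannZeta s‖ := by
    rw [← mul_div_assoc, le_div_iff₀ hd] at h4
    linarith
  calc (s.re - 1) ^ 2 / 27 = (s.re - 1) * ((s.re - 1) / 27) := by ring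
    _ ≤ _ := by gcongr

lemma one_lt_log_abs_add_three (t : ℝ) : 1 < Real.log (|t| + 3) := by
  rw [Real.lt_log_iff_exp_lt (by positivity)]
  have := Real.exp_one_lt_d9
  have := abs_nonneg t
  linarith

lemma norm_riemannZeta₁_le_of_dist_le {s z : ℂ} (hs : 1 ≤ s.re) (hs2 : s.re ≤ 2)
    (hz : ‖z‖ ≤ 1 / 2) : ‖riemannZeta₁ (s + z)‖ ≤ 12 * (|s.im| + 3) ^ 2 := by
  have h1 : -(1 / 2) ≤ z.re := by
    have := (neg_le_of_abs_le ((abs_re_le_norm z).trans hz)); linarith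
  have h2 := norm_riemannZeta₁_le (s := s + z) (by rw [add_re]; linarith)
  have h3 : ‖s‖ ≤ 2 + |s.im| := by
    refine (norm_le_abs_re_add_abs_im s).trans ?_
    rw [abs_of_nonneg (by linarith)]
    linarith
  have h4 := norm_add_le s z
  have h5 := abs_nonneg s.im
  have h6 : 1 + ‖s + z‖ ≤ 2 * (|s.im| + 3) := by linarith
  calc _ ≤ 3 * (2 * (|s.im| + 3)) ^ 2 := h2.trans (by gcongr)
    _ = _ := by ring

lemma log_div_riemannZeta₁_le {s : ℂ} {b : ℝ} (hb : 0 < b) (hs : 1 < s.re) (hs2 : s.re ≤ 2)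
    (h : b / (|s.im| + 3) ^ 2 ≤ s.re - 1) :
    Real.log (12 * (|s.im| + 3) ^ 2 / ‖riemannZeta₁ s‖) + 1 ≤
      (Real.log (324 / b ^ 2) + 1) + 6 * Real.log (|s.im| + 3) := by
  set τ := |s.im| + 3 with hτ
  have hτ0 : 0 < τ := by positivity
  have h1 := sq_div_le_norm_riemannZeta₁ hs hs2
  have h2 : b ^ 2 / τ ^ 4 / 27 ≤ ‖riemannZeta₁ s‖ := by
    refine le_trans ?_ h1
    gcongr
    calc b ^ 2 / τ ^ 4 = (b / τ ^ 2) ^ 2 := by rw [div_pow, ← pow_mul]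
      _ ≤ _ := by gcongr
  have h3 : 12 * τ ^ 2 / ‖riemannZeta₁ s‖ ≤ 324 / b ^ 2 * τ ^ 6 := by
    calc 12 * τ ^ 2 / ‖riemannZeta₁ s‖ ≤ 12 * τ ^ 2 / (b ^ 2 / τ ^ 4 / 27) := by gcongr
      _ = _ := by field_simp; norm_num
  have h4 : 0 < ‖riemannZeta₁ s‖ := norm_pos_iff.2 (riemannZeta₁_ne_zero_of_one_le_re hs.le)
  have h5 := Real.log_le_log (by positivity) h3
  rw [Real.log_mul (by positivity) (by positivity), Real.log_pow] at h5
  push_cast at h5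
  linarith

lemma exists_le_re_logDeriv_riemannZeta₁ : ∃ C > 0, ∀ s : ℂ, 1 < s.re → s.re ≤ 2 →
    1 / (|s.im| + 3) ^ 2 ≤ s.re - 1 →
    -(C * Real.log (|s.im| + 3)) ≤ (logDeriv riemannZeta₁ s).re ∧
    ∀ x : ℝ, 0 < x → x < 1 / 2 → riemannZeta₁ (s - x) = 0 →
      1 / x - C * Real.log (|s.im| + 3) ≤ (logDeriv riemannZeta₁ s).re := by
  refine ⟨96 * (Real.log 324 + 7) + 2, ?_, fun s hs hs2 h ↦ ?_⟩
  · have := Real.log_nonneg (show (1 : ℝ) ≤ 324 by norm_num)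
    positivity
  set f : ℂ → ℂ := fun z ↦ riemannZeta₁ (s + z) with hf_def
  have hf : Differentiable ℂ f := differentiable_riemannZeta₁.comp (by fun_prop)
  have hf0 : f 0 = riemannZeta₁ s := by simp [hf_def]
  have hne : f 0 ≠ 0 := by rw [hf0]; exact riemannZeta₁_ne_zero_of_one_le_re hs.le
  have hB : ∀ z ∈ closedBall (0 : ℂ) (1 / 2), ‖f z‖ ≤ 12 * (|s.im| + 3) ^ 2 := fun z hz ↦
    norm_riemannZeta₁_le_of_dist_le hs.le hs2 (by simpa using hz)
  have hz : ∀ z ∈ ball (0 : ℂ) (1 / 2), f z = 0 → z.re < 0 := by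
    intro z _ hfz
    by_contra! hcon
    exact riemannZeta₁_ne_zero_of_one_le_re (s := s + z) (by rw [add_re]; linarith) hfz
  have hd : logDeriv f 0 = logDeriv riemannZeta₁ s := by
    rw [logDeriv_apply, logDeriv_apply, hf0, hf_def, deriv_comp_const_add, add_zero]
  have hlog := log_div_riemannZeta₁_le one_pos hs hs2 h
  have hL := one_lt_log_abs_add_three s.im
  have h324 := Real.log_nonneg (show (1 : ℝ) ≤ 324 by norm_num)
  rw [one_pow, div_one] at hlog
  constructor
  · have h1 := neg_le_re_logDeriv (by norm_num) hf hne hB hz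
    rw [hd, hf0] at h1
    nlinarith
  · intro x hx hx2 hzero
    have h1 := inv_sub_le_re_logDeriv hx hx2 hf hne hB hz
      (by simpa [hf_def, sub_eq_add_neg] using hzero)
    rw [hd, hf0] at h1
    nlinarith

lemma LSeries_vonMangoldt_eq_inv_sub_logDeriv {s : ℂ} (hs : 1 < s.re) :
    LSeries (fun n ↦ (ArithmeticFunction.vonMangoldt n : ℂ)) s =
      1 / (s - 1) - logDeriv riemannZeta₁ s := by
  have hne : s ≠ 1 := fun h ↦ by simp [h] at hs
  have h0 := riemannZeta₁_ne_zero_of_one_le_re hs.le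
  have h1 := sub_ne_zero.2 hne
  rw [ArithmeticFunction.LSeries_vonMangoldt_eq_deriv_riemannZeta_div hs,
    deriv_riemannZeta_eq_neg_inv_sub_sq_mul_add hne, riemannZeta_eq_inv_sub_mul hne,
    logDeriv_apply]
  field_simp
  ring

lemma re_LSeries_vonMangoldt_comb_nonneg {σ : ℝ} (hσ : 1 < σ) (t : ℝ) :
    0 ≤ 3 * (LSeries (fun n ↦ (ArithmeticFunction.vonMangoldt n : ℂ)) σ).re
      + 4 * (LSeries (fun n ↦ (ArithmeticFunction.vonMangoldt n : ℂ)) (σ + t * I)).re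
      + (LSeries (fun n ↦ (ArithmeticFunction.vonMangoldt n : ℂ)) (σ + (2 * t : ℝ) * I)).re := by
  have hsum (u : ℝ) : HasSum (fun n : ℕ ↦ (LSeries.term
      (fun n ↦ (ArithmeticFunction.vonMangoldt n : ℂ)) (σ + u * I) n).re)
      (LSeries (fun n ↦ (ArithmeticFunction.vonMangoldt n : ℂ)) (σ + u * I)).re :=
    Complex.hasSum_re (ArithmeticFunction.LSeriesSummable_vonMangoldt (by simpa using hσ)).hasSum
  have h := (((hsum 0).mul_left 3).add ((hsum t).mul_left 4)).add (hsum (2 * t))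
  simp only [ofReal_zero, zero_mul, add_zero] at h
  refine h.nonneg fun n ↦ ?_
  have hterm (u : ℝ) : (LSeries.term (fun n ↦ (ArithmeticFunction.vonMangoldt n : ℂ))
      (σ + u * I) n).re = ArithmeticFunction.vonMangoldt n * (n : ℝ) ^ (-σ)
        * Real.cos (u * Real.log n) := by
    rcases eq_or_ne n 0 with rfl | hn
    · simp
    have hn0 : (0 : ℝ) < n := by positivity
    rw [LSeries.term_of_ne_zero hn, div_eq_mul_inv, ← cpow_neg, neg_add,
      cpow_add _ _ (by exact_mod_cast hn), re_ofReal_mul, ← ofReal_natCast, ← ofReal_neg,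
      ← ofReal_cpow hn0.le, re_ofReal_mul, cpow_def_of_ne_zero (by exact_mod_cast hn),
      ← ofReal_log hn0.le, mul_assoc]
    congr 2
    rw [show ((Real.log n : ℝ) : ℂ) * -(u * I) = ((-(u * Real.log n) : ℝ) : ℂ) * I by
      push_cast; ring, exp_ofReal_mul_I_re, Real.cos_neg]
  have h0 := hterm 0
  simp only [ofReal_zero, zero_mul, add_zero, Real.cos_zero] at h0
  rw [h0, hterm t, hterm (2 * t), mul_assoc 2 t, Real.cos_two_mul]
  have hpos : 0 ≤ ArithmeticFunction.vonMangoldt n * (n : ℝ) ^ (-σ) :=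
    mul_nonneg ArithmeticFunction.vonMangoldt_nonneg (by positivity)
  nlinarith [mul_nonneg hpos (sq_nonneg (1 + Real.cos (t * Real.log n)))]

end ZeroFreeRegion

section ZeroFreeBound

open Complex Metric

lemma exists_abs_logDeriv_riemannZeta₁_real_le :
    ∃ M ≥ (0 : ℝ), ∀ σ : ℝ, 1 ≤ σ → σ ≤ 2 → |(logDeriv riemannZeta₁ σ).re| ≤ M := by
  have hcont : ContinuousOn (fun σ : ℝ ↦ (logDeriv riemannZeta₁ σ).re) (Set.Icc 1 2) := by
    intro σ hσ
    have h0 : riemannZeta₁ σ ≠ 0 := riemannZeta₁_ne_zero_of_one_le_re (by simpa using hσ.1)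
    refine ContinuousAt.continuousWithinAt ?_
    simp only [logDeriv_apply]
    have hd : Continuous (deriv riemannZeta₁) :=
      (differentiable_riemannZeta₁.contDiff (n := 1)).continuous_deriv le_rfl
    have h1 : ContinuousAt (fun σ : ℝ ↦ deriv riemannZeta₁ σ / riemannZeta₁ σ) σ :=
      (hd.comp continuous_ofReal).continuousAt.div
        (differentiable_riemannZeta₁.continuous.comp continuous_ofReal).continuousAt h0
    exact continuous_re.continuousAt.comp h1
  obtain ⟨M, hM⟩ := isCompact_Icc.exists_bound_of_continuousOn hcont
  exact ⟨max M 0, le_max_right _ _, fun σ h1 h2 ↦ (hM σ ⟨h1, h2⟩).trans (le_max_left _ _)⟩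

lemma re_one_div_le_one {δ t : ℝ} (hδ : 0 < δ) (hδ1 : δ ≤ 1) (ht : 1 ≤ |t|) :
    (1 / ((δ : ℂ) + t * I)).re ≤ 1 := by
  have h1 : 1 ≤ normSq ((δ : ℂ) + t * I) := by
    rw [normSq_add_mul_I]
    nlinarith [sq_nonneg δ, sq_abs t]
  rw [one_div, inv_re, div_le_one (by linarith)]
  simpa using hδ1.trans h1

lemma exists_riemannZeta₁_ne_zero_of_le_abs_im : ∃ a > 0, ∃ T : ℝ, ∀ s : ℂ, T ≤ |s.im| →
    1 - a / Real.log (|s.im| + 3) < s.re → riemannZeta₁ s ≠ 0 := by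
  obtain ⟨C, hC, hCs⟩ := exists_le_re_logDeriv_riemannZeta₁
  obtain ⟨M, hM, hMs⟩ := exists_abs_logDeriv_riemannZeta₁_real_le
  set a : ℝ := 1 / (3 * (3 * M + 5 + 6 * C)) with ha
  have ha0 : 0 < a := by positivity
  have ha1 : a ≤ 1 / 15 := by
    rw [ha]; gcongr; linarith
  refine ⟨a / 6, by positivity, 1 / a, fun s ht hs hzero ↦ ?_⟩
  set L := Real.log (|s.im| + 3) with hL
  have hL1 : 1 < L := one_lt_log_abs_add_three _
  have hLτ : L ≤ |s.im| + 3 := (Real.log_le_sub_one_of_pos (by positivity)).trans (by linarith)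
  have ht1 : 1 ≤ |s.im| := le_trans (by rw [le_div_iff₀ ha0]; linarith) ht
  set δ := a / L with hδ
  have hδ0 : 0 < δ := by positivity
  have hδ1 : δ ≤ 1 / 15 := (div_le_self ha0.le hL1.le).trans ha1
  have hδτ : 1 / (|s.im| + 3) ^ 2 ≤ δ := by
    rw [hδ, div_le_div_iff₀ (by positivity) (by positivity)]
    rw [div_le_iff₀ ha0] at ht
    nlinarith [abs_nonneg s.im]
  have hre : s.re < 1 := by
    by_contra! hcon
    exact riemannZeta₁_ne_zero_of_one_le_re hcon hzero
  set x := 1 + δ - s.re with hx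
  have hx1 : δ < x := by linarith
  have hx2 : x < 7 / 6 * δ := by
    have : a / 6 / L = δ / 6 := by rw [hδ]; ring
    rw [this] at hs
    linarith
  have hnum (u : ℝ) : ((1 + δ : ℝ) : ℂ) + u * I - 1 = δ + u * I := by push_cast; ring
  have hval (u : ℝ) : (LSeries (fun n ↦ (ArithmeticFunction.vonMangoldt n : ℂ))
      ((1 + δ : ℝ) + u * I)).re = (1 / ((δ : ℂ) + u * I)).re
        - (logDeriv riemannZeta₁ ((1 + δ : ℝ) + u * I)).re := by
    rw [LSeries_vonMangoldt_eq_inv_sub_logDeriv (by simpa using hδ0), hnum, sub_re]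
  have h := re_LSeries_vonMangoldt_comb_nonneg (σ := 1 + δ) (by linarith) s.im
  have h0 := hval 0
  simp only [ofReal_zero, zero_mul, add_zero] at h0
  rw [h0, hval, hval, ← ofReal_one, ← ofReal_div, ofReal_re] at h
  have hA := (neg_le_of_abs_le (hMs (1 + δ) (by linarith) (by linarith)))
  have hB := (hCs ((1 + δ : ℝ) + s.im * I) (by simpa using hδ0) (by simp; linarith)
    (by simpa using hδτ)).2 x (by linarith) (by linarith) (by
      rwa [show ((1 + δ : ℝ) : ℂ) + s.im * I - x = s by apply Complex.ext <;> simp [hx]])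
  have hD := (hCs ((1 + δ : ℝ) + (2 * s.im : ℝ) * I) (by simpa using hδ0) (by simp; linarith)
    (by
      simp only [add_im, ofReal_im, mul_im, ofReal_re, I_re, I_im, mul_one, mul_zero, zero_add,
        add_zero, add_re, mul_re, sub_zero, add_sub_cancel_left]
      refine le_trans ?_ hδτ
      rw [abs_mul, abs_two]
      gcongr
      linarith)).1
  simp only [add_im, ofReal_im, mul_im, ofReal_re, I_re, I_im, mul_one, mul_zero, zero_add,
    add_zero] at hB hD
  have hL2 : Real.log (|2 * s.im| + 3) ≤ 2 * L := by
    rw [hL, show (2 : ℝ) * Real.log (|s.im| + 3) = Real.log ((|s.im| + 3) ^ 2) by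
      rw [Real.log_pow]; norm_num, abs_mul, abs_two]
    refine Real.log_le_log (by positivity) ?_
    nlinarith [abs_nonneg s.im]
  have hE := re_one_div_le_one hδ0 (by linarith) ht1
  have hF := re_one_div_le_one (t := 2 * s.im) hδ0 (by linarith)
    (by rw [abs_mul, abs_two]; linarith)
  have hx3 : 6 / (7 * δ) ≤ 1 / x := by
    rw [div_le_div_iff₀ (by positivity) (by linarith)]; linarith
  have hx4 : 6 / (7 * δ) = 6 / 7 * (1 / δ) := by field_simp
  have hδL : 1 / δ = L * (3 * (3 * M + 5 + 6 * C)) := by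
    rw [hδ, ha]; field_simp
  rw [← hL] at hB
  have hCL := mul_le_mul_of_nonneg_left hL2 hC.le
  simp only [ofReal_one] at *
  nlinarith

lemma exists_riemannZeta₁_ne_zero : ∃ c > 0, ∀ s : ℂ,
    1 - c / Real.log (|s.im| + 3) < s.re → riemannZeta₁ s ≠ 0 := by
  obtain ⟨a, ha, T, hT⟩ := exists_riemannZeta₁_ne_zero_of_le_abs_im
  set K : Set ℂ := (fun t : ℝ ↦ 1 + t * I) '' Set.Icc (-T) T with hK
  have hKc : IsCompact K := isCompact_Icc.image (by fun_prop)
  have hU : IsOpen {s : ℂ | riemannZeta₁ s ≠ 0} :=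
    isOpen_ne_fun differentiable_riemannZeta₁.continuous continuous_const
  obtain ⟨ε, hε, hεK⟩ := hKc.exists_thickening_subset_open hU (by
    rintro _ ⟨t, _, rfl⟩
    exact riemannZeta₁_ne_zero_of_one_le_re (by simp))
  refine ⟨min a ε, lt_min ha hε, fun s hs ↦ ?_⟩
  have hL := one_lt_log_abs_add_three s.im
  by_cases h : T ≤ |s.im|
  · refine hT s h (lt_of_le_of_lt ?_ hs)
    gcongr
    exact min_le_left _ _
  · by_cases h1 : 1 ≤ s.re
    · exact riemannZeta₁_ne_zero_of_one_le_re h1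
    · refine hεK (mem_thickening_iff.2 ⟨1 + s.im * I, ⟨s.im, ?_, rfl⟩, ?_⟩)
      · exact abs_le.1 (not_le.1 h).le
      · have h2 : s - (1 + s.im * I) = ((s.re - 1 : ℝ) : ℂ) := by
          apply Complex.ext <;> simp
        rw [dist_eq, h2, norm_real, Real.norm_eq_abs, abs_of_neg (by linarith)]
        have : min a ε / Real.log (|s.im| + 3) ≤ ε :=
          (div_le_self (lt_min ha hε).le hL.le).trans (min_le_right _ _)
        linarith

lemma exists_norm_logDeriv_riemannZeta₁_le : ∃ c > 0, c ≤ (1 / 2 : ℝ) ∧ ∃ C > 0, ∀ s : ℂ,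
    1 - c / Real.log (|s.im| + 3) ≤ s.re → s.re ≤ 2 →
      riemannZeta₁ s ≠ 0 ∧ ‖logDeriv riemannZeta₁ s‖ ≤ C * Real.sqrt (|s.im| + 3) := by
  obtain ⟨c₀, hc₀, hne⟩ := exists_riemannZeta₁_ne_zero
  set c := min c₀ 1 / 4 with hc
  have hc0 : 0 < c := by positivity
  have hc1 : c ≤ 1 / 4 := by rw [hc]; gcongr; exact min_le_right _ _
  have hcc : c ≤ c₀ / 4 := by rw [hc]; gcongr; exact min_le_left _ _
  set b := c / 4 with hb
  have hb0 : 0 < b := by positivity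
  set A := |Real.log (324 / b ^ 2)| + 7 with hA
  have hA0 : 0 < A := by positivity
  refine ⟨b, hb0, by linarith, 24 * A / c * 16, by positivity, fun s hs hs2 ↦ ?_⟩
  set τ := |s.im| + 3 with hτ
  set L := Real.log τ with hL
  have hL1 : 1 < L := one_lt_log_abs_add_three _
  have hτ3 : 3 ≤ τ := by have := abs_nonneg s.im; linarith
  have hLτ : L ≤ τ := (Real.log_le_sub_one_of_pos (by positivity)).trans (by linarith)
  set R := c / L with hR
  have hR0 : 0 < R := by positivity
  have hR1 : R ≤ 1 / 4 := (div_le_self hc0.le hL1.le).trans hc1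
  have hbR : b / L = R / 4 := by rw [hb, hR]; ring
  set σ := max s.re (1 + R / 4) with hσ
  set s₀ : ℂ := ⟨σ, s.im⟩ with hs₀
  have hσ1 : 1 + R / 4 ≤ σ := le_max_right _ _
  have hσ2 : σ ≤ 2 := max_le hs2 (by linarith)
  have hsσ : s.re ≤ σ := le_max_left _ _
  have hσs : σ - s.re ≤ R / 2 := by
    rw [hbR] at hs
    rcases max_cases s.re (1 + R / 4) with h | h <;> rw [hσ, h.1] <;> linarith
  set f : ℂ → ℂ := fun z ↦ riemannZeta₁ (s₀ + z) with hf_def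
  have hf : Differentiable ℂ f := differentiable_riemannZeta₁.comp (by fun_prop)
  have hf0 : f 0 = riemannZeta₁ s₀ := by simp [hf_def]
  have hfz : ∀ z ∈ ball (0 : ℂ) R, f z ≠ 0 := by
    intro z hz
    rw [mem_ball_zero_iff] at hz
    apply hne
    have hzr := neg_le_of_abs_le ((abs_re_le_norm z).trans hz.le)
    have hzi := (abs_im_le_norm z).trans hz.le
    have h1 : |(s₀ + z).im| + 3 ≤ τ ^ 2 := by
      rw [add_im]
      have := abs_add_le s.im z.im
      simp only [hs₀]
      nlinarith
    have h2 : Real.log (|(s₀ + z).im| + 3) ≤ 2 * L := by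
      rw [hL, show (2 : ℝ) * Real.log τ = Real.log (τ ^ 2) by rw [Real.log_pow]; norm_num]
      exact Real.log_le_log (by positivity) h1
    have h3 : c₀ / (2 * L) ≤ c₀ / Real.log (|(s₀ + z).im| + 3) := by
      have := one_lt_log_abs_add_three (s₀ + z).im
      gcongr
    have h4 : 2 * R ≤ c₀ / (2 * L) := by
      rw [hR, ← mul_div_assoc, div_le_div_iff₀ (by positivity) (by positivity)]
      nlinarith
    rw [add_re]
    simp only [hs₀]
    linarith
  have hB : ∀ z ∈ ball (0 : ℂ) R, ‖f z‖ ≤ 12 * τ ^ 2 := by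
    intro z hz
    rw [mem_ball_zero_iff] at hz
    exact norm_riemannZeta₁_le_of_dist_le (s := s₀) (by simp only [hs₀]; linarith)
      hσ2 (by linarith)
  set z : ℂ := s - s₀ with hz
  have hzn : ‖z‖ ≤ R / 2 := by
    have h2 : z = ((s.re - σ : ℝ) : ℂ) := by
      apply Complex.ext <;> simp [hz, hs₀]
    rw [h2, norm_real, Real.norm_eq_abs, abs_of_nonpos (by linarith)]
    linarith
  have hsz : s₀ + z = s := by rw [hz]; ring
  have hd : logDeriv f z = logDeriv riemannZeta₁ s := by
    rw [logDeriv_apply, logDeriv_apply, hf_def, deriv_comp_const_add]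
    simp only [hsz]
  refine ⟨?_, ?_⟩
  · have := hfz z (by rw [mem_ball_zero_iff]; linarith)
    simpa only [hf_def, hsz] using this
  have h1 := norm_logDeriv_le_of_ne_zero hR0 hf.differentiableOn hfz hB hzn
  have h2 := log_div_riemannZeta₁_le (s := s₀) hb0 (by simp only [hs₀]; linarith) hσ2 (by
    simp only [hs₀]
    have : b / τ ^ 2 ≤ b / L := by
      gcongr
      nlinarith
    linarith)
  rw [hd, hf0] at h1
  have h3 : Real.log (12 * τ ^ 2 / ‖riemannZeta₁ s₀‖) + 1 ≤ A * L := by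
    refine h2.trans ?_
    have := le_abs_self (Real.log (324 / b ^ 2))
    have h0 := abs_nonneg (Real.log (324 / b ^ 2))
    rw [hA]
    simp only [hs₀]
    nlinarith
  have h4 : L ≤ 4 * τ ^ (1 / 4 : ℝ) := by
    have := Real.log_le_rpow_div (x := τ) (ε := 1 / 4) (by linarith) (by norm_num)
    linarith
  have h5 : (τ ^ (1 / 4 : ℝ)) ^ 2 = Real.sqrt τ := by
    rw [Real.sqrt_eq_rpow, ← Real.rpow_natCast, ← Real.rpow_mul (by linarith)]
    norm_num
  calc _ ≤ 24 * (A * L) / R := h1.trans (by gcongr)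
    _ = 24 * A / c * L ^ 2 := by rw [hR]; field_simp
    _ ≤ 24 * A / c * (4 * τ ^ (1 / 4 : ℝ)) ^ 2 := by gcongr
    _ = _ := by rw [mul_pow, h5]; ring

end ZeroFreeBound

section PerronFormula

open Complex MeasureTheory

lemma hasMellin_one_sub_Ioc {s : ℂ} (hs : 0 < s.re) :
    HasMellin (Set.indicator (Set.Ioc 0 1) (fun t : ℝ ↦ 1 - (t : ℂ))) s
      (1 / (s * (s + 1))) := by
  have h0 := hasMellin_cpow_Ioc 0 (s := s) (by simpa using hs)
  have h1 := hasMellin_cpow_Ioc 1 (s := s) (by simp; linarith)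
  have h := hasMellin_sub h0.1 h1.1
  have hs0 : s ≠ 0 := fun h ↦ by simp [h] at hs
  have hs1 : s + 1 ≠ 0 := fun h ↦ by
    have := congrArg re h; simp at this; linarith
  rw [h0.2, h1.2] at h
  have hf : Set.indicator (Set.Ioc 0 1) (fun t : ℝ ↦ 1 - (t : ℂ)) = fun t ↦
      Set.indicator (Set.Ioc 0 1) (fun t : ℝ ↦ (t : ℂ) ^ (0 : ℂ)) t -
        Set.indicator (Set.Ioc 0 1) (fun t : ℝ ↦ (t : ℂ) ^ (1 : ℂ)) t := by
    ext t
    by_cases ht : t ∈ Set.Ioc (0 : ℝ) 1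
    · simp only [Set.indicator_of_mem ht, cpow_zero, cpow_one]
    · simp only [Set.indicator_of_notMem ht, sub_zero]
  have hv : 1 / (s * (s + 1)) = 1 / (s + 0) - 1 / (s + 1) := by
    rw [add_zero]; field_simp; ring
  rw [hf, hv]
  exact h

lemma hasMellin_sq_one_sub_div_Ioc {s : ℂ} (hs : 1 < s.re) :
    HasMellin (Set.indicator (Set.Ioc 0 1) (fun t : ℝ ↦ (1 - (t : ℂ)) ^ 2 / (2 * t))) s
      (1 / ((s - 1) * s * (s + 1))) := by
  have h0 := hasMellin_cpow_Ioc 0 (s := s) (by simp; linarith)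
  have h1 := hasMellin_cpow_Ioc 1 (s := s) (by simp; linarith)
  have h2 := hasMellin_cpow_Ioc (-1) (s := s) (by simp; linarith)
  have h3 := hasMellin_const_smul h2.1 (1 / 2 : ℂ)
  have h4 := hasMellin_const_smul h1.1 (1 / 2 : ℂ)
  have h5 := hasMellin_sub h3.1 h0.1
  have h := hasMellin_add h5.1 h4.1
  have hs0 : s ≠ 0 := fun h ↦ by
    have := congrArg re h; simp at this; linarith
  have hs1 : s + 1 ≠ 0 := fun h ↦ by
    have := congrArg re h; simp at this; linarith
  have hs2 : s - 1 ≠ 0 := fun h ↦ by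
    have := congrArg re h; simp at this; linarith
  rw [h5.2, h4.2, h3.2, h0.2, h1.2, h2.2] at h
  have hf : Set.indicator (Set.Ioc 0 1) (fun t : ℝ ↦ (1 - (t : ℂ)) ^ 2 / (2 * t)) = fun t ↦
      (1 / 2 : ℂ) • Set.indicator (Set.Ioc 0 1) (fun t : ℝ ↦ (t : ℂ) ^ (-1 : ℂ)) t -
        Set.indicator (Set.Ioc 0 1) (fun t : ℝ ↦ (t : ℂ) ^ (0 : ℂ)) t +
        (1 / 2 : ℂ) • Set.indicator (Set.Ioc 0 1) (fun t : ℝ ↦ (t : ℂ) ^ (1 : ℂ)) t := by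
    ext t
    by_cases ht : t ∈ Set.Ioc (0 : ℝ) 1
    · have ht0 : (t : ℂ) ≠ 0 := by exact_mod_cast ht.1.ne'
      simp only [Set.indicator_of_mem ht, cpow_zero, cpow_one, cpow_neg_one, smul_eq_mul]
      field_simp
      ring
    · simp only [Set.indicator_of_notMem ht, sub_zero, smul_zero, add_zero]
  have hv : 1 / ((s - 1) * s * (s + 1)) =
      (1 / 2 : ℂ) • (1 / (s + -1)) - 1 / (s + 0) + (1 / 2 : ℂ) • (1 / (s + 1)) := by
    rw [add_zero, ← sub_eq_add_neg, smul_eq_mul, smul_eq_mul]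
    field_simp
    ring
  rw [hf, hv]
  exact h

lemma one_add_sq_div_four_le_norm {σ : ℝ} (hσ : 1 / 2 ≤ σ) (t : ℝ) :
    (1 + t ^ 2) / 4 ≤ ‖((σ : ℂ) + t * I) * (σ + t * I + 1)‖ := by
  have h1 : ‖(σ : ℂ) + t * I‖ ^ 2 = σ ^ 2 + t ^ 2 := by
    rw [← normSq_eq_norm_sq, normSq_add_mul_I]
  have h2 : ‖(σ : ℂ) + t * I‖ ≤ ‖(σ : ℂ) + t * I + 1‖ := by
    refine le_of_sq_le_sq ?_ (norm_nonneg _)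
    rw [show (σ : ℂ) + t * I + 1 = ((σ + 1 : ℝ) : ℂ) + t * I by push_cast; ring, h1,
      ← normSq_eq_norm_sq, normSq_add_mul_I]
    nlinarith
  rw [norm_mul]
  nlinarith [norm_nonneg ((σ : ℂ) + t * I), sq_nonneg t]

lemma verticalLine_ne_zero {σ : ℝ} (hσ : 1 / 2 ≤ σ) (t : ℝ) :
    ((σ : ℂ) + t * I) * (σ + t * I + 1) ≠ 0 := by
  rw [← norm_pos_iff]
  refine lt_of_lt_of_le (by positivity) (one_add_sq_div_four_le_norm hσ t)

lemma norm_one_div_verticalLine_le {σ : ℝ} (hσ : 1 / 2 ≤ σ) (t : ℝ) :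
    ‖1 / (((σ : ℂ) + t * I) * (σ + t * I + 1))‖ ≤ 4 * (1 + t ^ 2)⁻¹ := by
  rw [norm_div, norm_one, one_div, ← inv_inv (4 : ℝ), ← mul_inv]
  refine inv_anti₀ (by positivity) ?_
  have := one_add_sq_div_four_le_norm hσ t
  linarith

lemma continuous_one_div_verticalLine {σ : ℝ} (hσ : 1 / 2 ≤ σ) :
    Continuous fun t : ℝ ↦ 1 / (((σ : ℂ) + t * I) * (σ + t * I + 1)) :=
  continuous_const.div (by fun_prop) (verticalLine_ne_zero hσ)

lemma integrable_one_div_verticalLine {σ : ℝ} (hσ : 1 / 2 ≤ σ) :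
    Integrable fun t : ℝ ↦ 1 / (((σ : ℂ) + t * I) * (σ + t * I + 1)) :=
  (integrable_inv_one_add_sq.const_mul 4).mono'
    (continuous_one_div_verticalLine hσ).aestronglyMeasurable
    (.of_forall (norm_one_div_verticalLine_le hσ))

lemma integral_cpow_neg_div_eq_max {u σ : ℝ} (hu : 0 < u) (hσ : 1 / 2 ≤ σ) :
    (1 / (2 * Real.pi) : ℝ) • ∫ t : ℝ, (u : ℂ) ^ (-((σ : ℂ) + t * I)) *
      (1 / (((σ : ℂ) + t * I) * (σ + t * I + 1))) = ((max (1 - u) 0 : ℝ) : ℂ) := by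
  have hm (t : ℝ) := hasMellin_one_sub_Ioc (s := (σ : ℂ) + t * I) (by simp; linarith)
  have h0 := hasMellin_one_sub_Ioc (s := (σ : ℂ)) (by simp; linarith)
  have hev : (fun t : ℝ ↦ ((max (1 - t) 0 : ℝ) : ℂ)) =ᶠ[nhds u]
      Set.indicator (Set.Ioc 0 1) (fun t : ℝ ↦ 1 - (t : ℂ)) := by
    filter_upwards [lt_mem_nhds hu] with t ht
    by_cases h1 : t ≤ 1
    · rw [Set.indicator_of_mem (Set.mem_Ioc.2 ⟨ht, h1⟩), max_eq_left (by linarith)]; push_cast; rfl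
    · rw [Set.indicator_of_notMem (fun h ↦ h1 h.2), max_eq_right (by linarith)]; simp
  have h := mellinInv_mellin_eq σ _ hu h0.1 ?_ (ContinuousAt.congr (by fun_prop) hev)
  · rw [mellinInv, ← hev.self_of_nhds] at h
    refine Eq.trans ?_ h
    simp_rw [smul_eq_mul, (hm _).2]
  · rw [VerticalIntegrable]
    simp_rw [(hm _).2]
    exact integrable_one_div_verticalLine hσ

lemma integral_cpow_neg_div_eq_sq {u σ : ℝ} (hu : 0 < u) (hu1 : u < 1) (hσ : 1 < σ) :
    (1 / (2 * Real.pi) : ℝ) • ∫ t : ℝ, (u : ℂ) ^ (-((σ : ℂ) + t * I)) *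
      (1 / (σ + t * I - 1) * (1 / (((σ : ℂ) + t * I) * (σ + t * I + 1)))) =
        (((1 - u) ^ 2 / (2 * u) : ℝ) : ℂ) := by
  have hm (t : ℝ) := hasMellin_sq_one_sub_div_Ioc (s := (σ : ℂ) + t * I) (by simpa using hσ)
  have h0 := hasMellin_sq_one_sub_div_Ioc (s := (σ : ℂ)) (by simpa using hσ)
  have hev : (fun t : ℝ ↦ (((1 - t) ^ 2 / (2 * t) : ℝ) : ℂ)) =ᶠ[nhds u]
      Set.indicator (Set.Ioc 0 1) (fun t : ℝ ↦ (1 - (t : ℂ)) ^ 2 / (2 * t)) := by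
    filter_upwards [Ioo_mem_nhds hu hu1] with t ht
    rw [Set.indicator_of_mem (Set.mem_Ioc.2 ⟨ht.1, ht.2.le⟩)]; push_cast; rfl
  have heq (t : ℝ) : 1 / (((σ : ℂ) + t * I - 1) * (σ + t * I) * (σ + t * I + 1)) =
      1 / (σ + t * I - 1) * (1 / (((σ : ℂ) + t * I) * (σ + t * I + 1))) := by
    rw [one_div_mul_one_div, mul_assoc]
  have hcont : ContinuousAt (fun t : ℝ ↦ (((1 - t) ^ 2 / (2 * t) : ℝ) : ℂ)) u := by
    refine continuous_ofReal.continuousAt.comp (f := fun t : ℝ ↦ (1 - t) ^ 2 / (2 * t)) ?_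
    exact ContinuousAt.div (by fun_prop) (by fun_prop) (by positivity)
  have hσ' : σ - 1 ≠ 0 := by linarith
  have hne (t : ℝ) : (σ : ℂ) + t * I - 1 ≠ 0 := fun h ↦ hσ' (by simpa using congrArg re h)
  have h := mellinInv_mellin_eq σ _ hu h0.1 ?_ (hcont.congr hev)
  · rw [mellinInv, ← hev.self_of_nhds] at h
    refine Eq.trans ?_ h
    simp_rw [smul_eq_mul, (hm _).2, heq]
  · rw [VerticalIntegrable]
    simp_rw [(hm _).2, heq]
    refine Integrable.bdd_mul (c := 1 / (σ - 1)) (integrable_one_div_verticalLine (by linarith))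
      (Continuous.aestronglyMeasurable ?_) (.of_forall fun t ↦ ?_)
    · exact continuous_const.div (by fun_prop) hne
    · rw [norm_div, norm_one]
      refine one_div_le_one_div_of_le (by linarith) ?_
      have := (le_abs_self _).trans (abs_re_le_norm ((σ : ℂ) + t * I - 1))
      simpa using this

lemma integral_logDeriv_riemannZeta₁ {x σ : ℝ} (hx : 1 < x) (hσ : 1 < σ) :
    ((∑ n ∈ Icc 1 ⌊x⌋₊, ArithmeticFunction.vonMangoldt n * (1 - n / x)
      - (x - 1) ^ 2 / (2 * x) : ℝ) : ℂ) = (1 / (2 * Real.pi) : ℝ) • ∫ t : ℝ,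
        -logDeriv riemannZeta₁ (σ + t * I) * (x : ℂ) ^ ((σ : ℂ) + t * I) *
          (1 / (((σ : ℂ) + t * I) * (σ + t * I + 1))) := by
  have hx0 : 0 < x := by linarith
  have hσ2 : 1 / 2 ≤ σ := by linarith
  set Λ : ℕ → ℂ := fun n ↦ (ArithmeticFunction.vonMangoldt n : ℂ) with hΛ
  set k : ℝ → ℂ := fun t ↦ 1 / (((σ : ℂ) + t * I) * (σ + t * I + 1)) with hk
  set F : ℕ → ℝ → ℂ := fun n t ↦ LSeries.term Λ (σ + t * I) n *
    (x : ℂ) ^ ((σ : ℂ) + t * I) * k t with hF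
  have hxnorm (t : ℝ) : ‖(x : ℂ) ^ ((σ : ℂ) + t * I)‖ = x ^ σ := by
    rw [norm_cpow_eq_rpow_re_of_pos hx0]; simp
  have hxcont : Continuous fun t : ℝ ↦ (x : ℂ) ^ ((σ : ℂ) + t * I) :=
    Continuous.const_cpow (by fun_prop) (.inl (by exact_mod_cast hx0.ne'))
  have hkint : Integrable k := integrable_one_div_verticalLine hσ2
  have hsummable (t : ℝ) : LSeriesSummable Λ ((σ : ℂ) + t * I) :=
    ArithmeticFunction.LSeriesSummable_vonMangoldt (by simpa using hσ)
  have htnorm (n : ℕ) (t : ℝ) : ‖LSeries.term Λ (σ + t * I) n‖ = ‖LSeries.term Λ σ n‖ := by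
    rw [LSeries.norm_term_eq, LSeries.norm_term_eq]; simp
  have htcont (n : ℕ) : Continuous fun t : ℝ ↦ LSeries.term Λ (σ + t * I) n := by
    rcases eq_or_ne n 0 with rfl | hn
    · simpa using continuous_const
    · simp_rw [LSeries.term_of_ne_zero hn]
      refine continuous_const.div
        (Continuous.const_cpow (by fun_prop) (.inl (by exact_mod_cast hn))) fun t ↦ ?_
      simp [cpow_eq_zero_iff, hn]
  have hFint (n : ℕ) : Integrable (F n) := by
    refine Integrable.bdd_mul (c := ‖LSeries.term Λ σ n‖ * x ^ σ) hkint
      ((htcont n).mul hxcont).aestronglyMeasurable (.of_forall fun t ↦ ?_)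
    rw [norm_mul, hxnorm, htnorm]
  have hFnorm (n : ℕ) : ∫ t, ‖F n t‖ = ‖LSeries.term Λ σ n‖ * (x ^ σ * ∫ t, ‖k t‖) := by
    rw [← integral_const_mul, ← integral_const_mul]
    congr 1
    ext t
    rw [hF]
    simp only [norm_mul, hxnorm, htnorm]
    ring
  have hFsum : Summable fun n ↦ ∫ t, ‖F n t‖ := by
    simp_rw [hFnorm]
    have := (hsummable 0).norm
    simp only [ofReal_zero, zero_mul, add_zero] at this
    exact this.mul_right _
  have h1 := hasSum_integral_of_summable_integral_norm hFint hFsum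
  have hFtsum (t : ℝ) : ∑' n, F n t = -logDeriv riemannZeta₁ (σ + t * I) *
      (x : ℂ) ^ ((σ : ℂ) + t * I) * k t + ((1 / x : ℝ) : ℂ) ^ (-((σ : ℂ) + t * I)) *
        (1 / (σ + t * I - 1) * k t) := by
    have h2 : ((1 / x : ℝ) : ℂ) ^ (-((σ : ℂ) + t * I)) = (x : ℂ) ^ ((σ : ℂ) + t * I) := by
      rw [one_div, ofReal_inv, inv_cpow, cpow_neg, inv_inv]
      rw [arg_ofReal_of_nonneg hx0.le]
      exact Real.pi_pos.ne
    simp only [hF]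
    rw [tsum_mul_right, tsum_mul_right, h2]
    change LSeries Λ _ * _ * _ = _
    rw [LSeries_vonMangoldt_eq_inv_sub_logDeriv (by simpa using hσ)]
    ring
  have hmain := integral_cpow_neg_div_eq_sq (u := 1 / x) (by positivity)
    ((div_lt_one hx0).2 hx) hσ
  have hFval (n : ℕ) : (1 / (2 * Real.pi) : ℝ) • ∫ t, F n t =
      ((ArithmeticFunction.vonMangoldt n * max (1 - n / x) 0 : ℝ) : ℂ) := by
    rcases eq_or_ne n 0 with rfl | hn
    · simp [hF]
    have hn0 : (0 : ℝ) < n := by positivity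
    rw [ofReal_mul, ← integral_cpow_neg_div_eq_max (u := n / x) (by positivity) hσ2,
      mul_smul_comm, ← integral_const_mul]
    congr 2
    ext t
    simp only [hF, LSeries.term_of_ne_zero hn]
    rw [ofReal_div, div_cpow_ofReal_nonneg hn0.le hx0.le, cpow_neg, cpow_neg, div_inv_eq_mul,
      ofReal_natCast]
    ring
  have hs1 (t : ℝ) : σ - 1 ≤ ‖(σ : ℂ) + t * I - 1‖ := by
    simpa using (le_abs_self _).trans (abs_re_le_norm ((σ : ℂ) + t * I - 1))
  have hs1' (t : ℝ) : ‖1 / ((σ : ℂ) + t * I - 1)‖ ≤ 1 / (σ - 1) := by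
    rw [norm_div, norm_one]
    exact one_div_le_one_div_of_le (by linarith) (hs1 t)
  have hne (t : ℝ) : (σ : ℂ) + t * I - 1 ≠ 0 :=
    norm_pos_iff.1 (lt_of_lt_of_le (by linarith) (hs1 t))
  have hAint : Integrable fun t : ℝ ↦ -logDeriv riemannZeta₁ (σ + t * I) *
      (x : ℂ) ^ ((σ : ℂ) + t * I) * k t := by
    refine Integrable.bdd_mul (c := ((∑' n, ‖LSeries.term Λ σ n‖) + 1 / (σ - 1)) * x ^ σ) hkint
      (Continuous.aestronglyMeasurable (.mul ?_ hxcont)) (.of_forall fun t ↦ ?_)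
    · simp only [logDeriv_apply]
      refine (Continuous.div ?_ ?_ fun t ↦
        riemannZeta₁_ne_zero_of_one_le_re (by simpa using hσ.le)).neg
      · exact ((differentiable_riemannZeta₁.contDiff (n := 1)).continuous_deriv le_rfl).comp
          (by fun_prop)
      · exact differentiable_riemannZeta₁.continuous.comp (by fun_prop)
    · rw [norm_mul, hxnorm]
      gcongr
      have h3 := LSeries_vonMangoldt_eq_inv_sub_logDeriv (s := σ + t * I) (by simpa using hσ)
      have h4 : -logDeriv riemannZeta₁ (σ + t * I) =
          LSeries Λ (σ + t * I) - 1 / (σ + t * I - 1) := by rw [h3]; ring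
      rw [h4]
      refine (norm_sub_le _ _).trans (add_le_add ?_ (hs1' t))
      simp_rw [← htnorm _ t]
      exact norm_tsum_le_tsum_norm (hsummable t).norm
  have hBint : Integrable fun t : ℝ ↦ ((1 / x : ℝ) : ℂ) ^ (-((σ : ℂ) + t * I)) *
      (1 / (σ + t * I - 1) * k t) := by
    simp_rw [← mul_assoc]
    refine Integrable.bdd_mul (c := (1 / x) ^ (-σ) * (1 / (σ - 1))) hkint
      (Continuous.aestronglyMeasurable (.mul ?_ ?_)) (.of_forall fun t ↦ ?_)
    · exact Continuous.const_cpow (by fun_prop)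
        (.inl (by exact_mod_cast (one_div_pos.2 hx0).ne'))
    · exact continuous_const.div (by fun_prop) hne
    · rw [norm_mul, norm_cpow_eq_rpow_re_of_pos (by positivity)]
      refine mul_le_mul (by simp) (hs1' t) (norm_nonneg _) (by positivity)
  simp_rw [hFtsum] at h1
  rw [integral_add hAint hBint] at h1
  have h2 := h1.const_smul (1 / (2 * Real.pi) : ℝ)
  simp_rw [hFval] at h2
  rw [smul_add, hmain] at h2
  have h3 : HasSum (fun n : ℕ ↦ ((ArithmeticFunction.vonMangoldt n * max (1 - n / x) 0 : ℝ) : ℂ))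
      (∑ n ∈ Icc 1 ⌊x⌋₊,
        ((ArithmeticFunction.vonMangoldt n * max (1 - n / x) 0 : ℝ) : ℂ)) := by
    refine hasSum_sum_of_ne_finset_zero fun n hn ↦ ?_
    rcases eq_or_ne n 0 with rfl | hn0
    · simp
    · rw [mem_Icc, not_and_or, not_le, not_le, Nat.floor_lt hx0.le] at hn
      rw [max_eq_right, mul_zero, ofReal_zero]
      rw [sub_nonpos, one_le_div hx0]
      exact (hn.resolve_left (by omega)).le
  have h4 := h3.unique h2
  rw [← sub_eq_iff_eq_add] at h4
  rw [← h4, ofReal_sub, ofReal_sum]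
  congr 1
  · refine sum_congr rfl fun n hn ↦ ?_
    rw [max_eq_left]
    rw [sub_nonneg, div_le_one hx0]
    exact (Nat.le_floor_iff hx0.le).1 (mem_Icc.1 hn).2
  · congr 1
    field_simp

end PerronFormula

section ContourShift

open Complex MeasureTheory

lemma sqrt_abs_add_three_le (t : ℝ) :
    Real.sqrt (|t| + 3) ≤ 2 * (1 + t ^ 2) ^ (1 / 4 : ℝ) := by
  have h1 : |t| + 3 ≤ 4 * Real.sqrt (1 + t ^ 2) := by
    have h2 : |t| ≤ Real.sqrt (1 + t ^ 2) := Real.abs_le_sqrt (by linarith)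
    have h3 : 1 ≤ Real.sqrt (1 + t ^ 2) := Real.one_le_sqrt.2 (by nlinarith)
    linarith
  have h4 : (2 * (1 + t ^ 2) ^ (1 / 4 : ℝ)) ^ 2 = 4 * Real.sqrt (1 + t ^ 2) := by
    rw [mul_pow, Real.sqrt_eq_rpow, ← Real.rpow_natCast ((1 + t ^ 2) ^ (1 / 4 : ℝ)),
      ← Real.rpow_mul (by positivity)]
    norm_num
  rw [Real.sqrt_le_left (by positivity), h4]
  exact h1

lemma integrable_one_add_sq_rpow :
    Integrable fun t : ℝ ↦ (1 + t ^ 2) ^ (-(5 / 8) : ℝ) := by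
  have := integrable_rpow_neg_one_add_norm_sq (E := ℝ) (μ := volume) (r := 5 / 4) (by norm_num)
  norm_num at this
  simpa using this

lemma one_add_sq_rpow_le_of_le_abs {T t : ℝ} (hT : 0 < T) (ht : T ≤ |t|) :
    (1 + t ^ 2) ^ (-(3 / 4) : ℝ) ≤ T ^ (-(1 / 4) : ℝ) * (1 + t ^ 2) ^ (-(5 / 8) : ℝ) := by
  have h0 : 0 < 1 + t ^ 2 := by positivity
  have h1 : T ^ 2 ≤ 1 + t ^ 2 := by
    have := pow_le_pow_left₀ hT.le ht 2
    rw [sq_abs] at this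
    linarith
  have h2 : (1 + t ^ 2) ^ (-(1 / 8) : ℝ) ≤ T ^ (-(1 / 4) : ℝ) := by
    calc (1 + t ^ 2) ^ (-(1 / 8) : ℝ) ≤ (T ^ 2) ^ (-(1 / 8) : ℝ) :=
          Real.rpow_le_rpow_of_nonpos (by positivity) h1 (by norm_num)
      _ = T ^ (-(1 / 4) : ℝ) := by
          rw [← Real.rpow_natCast, ← Real.rpow_mul hT.le]
          norm_num
  rw [show (-(3 / 4) : ℝ) = -(1 / 8) + -(5 / 8) by norm_num, Real.rpow_add h0]
  gcongr

lemma one_add_sq_rpow_le (t : ℝ) :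
    (1 + t ^ 2) ^ (-(3 / 4) : ℝ) ≤ (1 + t ^ 2) ^ (-(5 / 8) : ℝ) :=
  Real.rpow_le_rpow_of_exponent_le (by nlinarith) (by norm_num)

lemma norm_neg_mul_cpow_mul_le {C x σ t : ℝ} (hC : 0 ≤ C) (hx : 0 < x) (hσ : 1 / 2 ≤ σ) {d : ℂ}
    (hd : ‖d‖ ≤ C * Real.sqrt (|t| + 3)) :
    ‖-d * (x : ℂ) ^ ((σ : ℂ) + t * I) * (1 / (((σ : ℂ) + t * I) * (σ + t * I + 1)))‖ ≤
      8 * C * x ^ σ * (1 + t ^ 2) ^ (-(3 / 4) : ℝ) := by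
  have h0 : 0 < 1 + t ^ 2 := by positivity
  have h1 := norm_one_div_verticalLine_le hσ t
  have h2 : ‖(x : ℂ) ^ ((σ : ℂ) + t * I)‖ = x ^ σ := by
    rw [norm_cpow_eq_rpow_re_of_pos hx]; simp
  have h3 := hd.trans (mul_le_mul_of_nonneg_left (sqrt_abs_add_three_le t) hC)
  rw [norm_mul, norm_mul, norm_neg, h2]
  calc _ ≤ C * (2 * (1 + t ^ 2) ^ (1 / 4 : ℝ)) * x ^ σ * (4 * (1 + t ^ 2)⁻¹) := by gcongr
    _ = 8 * C * x ^ σ * ((1 + t ^ 2) ^ (1 / 4 : ℝ) * (1 + t ^ 2) ^ (-1 : ℝ)) := by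
        rw [Real.rpow_neg_one]; ring
    _ = _ := by rw [← Real.rpow_add h0]; norm_num

lemma exists_abs_sum_vonMangoldt_mul_one_sub_le : ∃ c > 0, ∃ C > 0, ∀ x : ℝ, 3 ≤ x →
    |∑ n ∈ Icc 1 ⌊x⌋₊, ArithmeticFunction.vonMangoldt n * (1 - n / x) -
      (x - 1) ^ 2 / (2 * x)| ≤ C * x * Real.exp (-c * Real.sqrt (Real.log x)) := by
  obtain ⟨c, hc, hc2, C, hC, hbd⟩ := exists_norm_logDeriv_riemannZeta₁_le
  set v : ℝ → ℝ := fun t ↦ (1 + t ^ 2) ^ (-(5 / 8) : ℝ) with hv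
  have hv0 (t : ℝ) : 0 ≤ v t := by simp only [hv]; positivity
  have hvint : Integrable v := integrable_one_add_sq_rpow
  set J := ∫ t, v t with hJ
  have hJ0 : 0 ≤ J := integral_nonneg hv0
  refine ⟨c / 3, by positivity, 8 * C * Real.exp 1 * (2 * J + 4), by positivity, fun x hx ↦ ?_⟩
  have hx0 : 0 < x := by linarith
  have hlog1 : 1 ≤ Real.log x := by
    rw [Real.le_log_iff_exp_le hx0]
    have := Real.exp_one_lt_d9
    linarith
  set l := Real.sqrt (Real.log x) with hl
  have hl1 : 1 ≤ l := Real.one_le_sqrt.2 hlog1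
  have hl2 : l ^ 2 = Real.log x := Real.sq_sqrt (by linarith)
  set T := Real.exp l with hT
  have hT0 : 0 < T := Real.exp_pos l
  have hT1 : 1 ≤ T := Real.one_le_exp (by linarith)
  set D := Real.exp (-(c / 3) * l) with hD
  have hTD : T ^ (-(1 / 4) : ℝ) ≤ D := by
    rw [hT, ← Real.exp_mul, hD]
    exact Real.exp_le_exp.2 (by nlinarith)
  set b := c / Real.log (T + 3) with hb
  have hlogT : 1 < Real.log (T + 3) := by
    have := one_lt_log_abs_add_three T
    rwa [abs_of_pos hT0] at this
  have hlogT2 : Real.log (T + 3) ≤ 3 * l := by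
    have h1 : Real.log (T + 3) ≤ Real.log (4 * T) := Real.log_le_log (by positivity) (by linarith)
    have h2 : Real.log 4 = 2 * Real.log 2 := by
      rw [show (4 : ℝ) = 2 ^ 2 by norm_num, Real.log_pow]; norm_num
    have h3 := Real.log_two_lt_d9
    rw [Real.log_mul (by norm_num) hT0.ne', hT, Real.log_exp] at h1
    linarith
  have hb0 : 0 < b := by positivity
  have hb1 : b ≤ 1 / 2 := (div_le_self hc.le hlogT.le).trans hc2
  have hbl : c / (3 * l) ≤ b := by rw [hb]; gcongr
  set σ := 1 + 1 / Real.log x with hσ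
  have hσ1 : 1 < σ := by
    have : 0 < 1 / Real.log x := by positivity
    linarith
  have hσ2 : σ ≤ 2 := by
    have : 1 / Real.log x ≤ 1 := by rw [div_le_one (by linarith)]; exact hlog1
    linarith
  have hxσ : x ^ σ = Real.exp 1 * x := by
    rw [hσ, Real.rpow_add hx0, Real.rpow_one, one_div, Real.rpow_def_of_pos hx0,
      mul_inv_cancel₀ (by linarith), mul_comm]
  have hxb : x ^ (1 - b) ≤ x * D := by
    rw [sub_eq_add_neg, Real.rpow_add hx0, Real.rpow_one, Real.rpow_def_of_pos hx0, ← hl2, hD]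
    refine mul_le_mul_of_nonneg_left (Real.exp_le_exp.2 ?_) hx0.le
    have h1 : c / 3 * l ≤ l ^ 2 * b := by
      calc c / 3 * l = l ^ 2 * (c / (3 * l)) := by field_simp
        _ ≤ _ := by gcongr
    linarith
  set H : ℂ → ℂ := fun s ↦ -logDeriv riemannZeta₁ s * (x : ℂ) ^ s * (1 / (s * (s + 1))) with hH
  have hreg {s : ℂ} (h1 : |s.im| ≤ T) (h2 : 1 - b ≤ s.re) :
      1 - c / Real.log (|s.im| + 3) ≤ s.re := by
    have h3 : b ≤ c / Real.log (|s.im| + 3) := by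
      have := one_lt_log_abs_add_three s.im
      rw [hb]
      gcongr
    linarith
  have hreg' (t : ℝ) : 1 - c / Real.log (|((σ : ℂ) + t * I).im| + 3) ≤
      ((σ : ℂ) + t * I).re := by
    have h1 := one_lt_log_abs_add_three ((σ : ℂ) + t * I).im
    have h2 : 0 < c / Real.log (|((σ : ℂ) + t * I).im| + 3) := by positivity
    have h3 : ((σ : ℂ) + t * I).re = σ := by simp
    linarith
  have hHbd {a t : ℝ} (h1 : 1 / 2 ≤ a) (h2 : a ≤ 2) (h3 : 1 - c / Real.log (|t| + 3) ≤ a) :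
      ‖H (a + t * I)‖ ≤ 8 * C * x ^ a * (1 + t ^ 2) ^ (-(3 / 4) : ℝ) := by
    refine norm_neg_mul_cpow_mul_le hC.le hx0 h1 ?_
    have := (hbd (a + t * I) (by simpa using h3) (by simpa using h2)).2
    simpa using this
  have hdiff : DifferentiableOn ℂ H
      (Set.uIcc (1 - b) σ ×ℂ Set.uIcc (-T) T) := by
    intro s hs
    rw [mem_reProdIm, Set.uIcc_of_le (by linarith), Set.uIcc_of_le (by linarith)] at hs
    have hs1 : riemannZeta₁ s ≠ 0 :=
      (hbd s (hreg (abs_le.2 hs.2) hs.1.1) (hs.1.2.trans hσ2)).1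
    have hs2 : s * (s + 1) ≠ 0 := by
      have := verticalLine_ne_zero (σ := s.re) (by linarith [hs.1.1]) s.im
      rwa [re_add_im] at this
    refine DifferentiableAt.differentiableWithinAt ?_
    have hd1 : DifferentiableAt ℂ (logDeriv riemannZeta₁) s := by
      rw [logDeriv]
      exact ((differentiable_riemannZeta₁.contDiff (n := 2)).differentiable_deriv_two s).div
        (differentiable_riemannZeta₁ s) hs1
    refine (hd1.neg.mul ?_).mul ?_
    · exact (differentiableAt_id).const_cpow (.inl (by exact_mod_cast hx0.ne'))
    · exact (differentiableAt_const _).div (by fun_prop) hs2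
  have hrect := integral_boundary_rect_eq_zero_of_differentiableOn H ⟨1 - b, -T⟩ ⟨σ, T⟩ hdiff
  simp only at hrect
  have hcorner : ∀ t : ℝ, |t| = T → ‖∫ a : ℝ in (1 - b)..σ, H (a + t * I)‖ ≤
      8 * C * (Real.exp 1 * x) * D * 2 := by
    intro t ht
    refine (intervalIntegral.norm_integral_le_of_norm_le_const (C := 8 * C * (Real.exp 1 * x) * D)
      fun a ha ↦ ?_).trans ?_
    · rw [Set.uIoc_of_le (by linarith)] at ha
      refine (hHbd (by linarith [ha.1]) (ha.2.trans hσ2) ?_).trans ?_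
      · have := hreg (s := a + t * I) (by simp [ht]) (by simpa using ha.1.le)
        simpa using this
      · rw [← hxσ]
        have h1 : x ^ a ≤ x ^ σ := Real.rpow_le_rpow_of_exponent_le (by linarith) ha.2
        have h2 : (1 + t ^ 2) ^ (-(3 / 4) : ℝ) ≤ D := by
          refine (one_add_sq_rpow_le_of_le_abs hT0 ht.ge).trans ?_
          refine (mul_le_of_le_one_right (by positivity) ?_).trans hTD
          exact Real.rpow_le_one_of_one_le_of_nonpos (by nlinarith) (by norm_num)
        gcongr
    · gcongr
      rw [abs_of_nonneg (by linarith)]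
      linarith
  have hleft : ‖∫ t : ℝ in (-T)..T, H ((1 - b : ℝ) + t * I)‖ ≤ 8 * C * (x * D) * J := by
    refine (intervalIntegral.norm_integral_le_of_norm_le (g := fun t ↦ 8 * C * (x * D) * v t)
      (by linarith) (.of_forall fun t ht ↦ ?_)
      (hvint.const_mul _).intervalIntegrable).trans ?_
    · have h1 := hreg (s := (1 - b : ℝ) + t * I) (by simpa using abs_le.2 ⟨ht.1.le, ht.2⟩) (by simp)
      refine (hHbd (by linarith) (by linarith) (by simpa using h1)).trans ?_
      have := one_add_sq_rpow_le t
      gcongr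
    · rw [intervalIntegral.integral_of_le (by linarith), ← integral_const_mul]
      exact setIntegral_le_integral (hvint.const_mul _)
        (.of_forall fun t ↦ mul_nonneg (by positivity) (hv0 t))
  have hHint : Integrable fun t : ℝ ↦ H (σ + t * I) := by
    refine (hvint.const_mul (8 * C * x ^ σ)).mono' (Continuous.aestronglyMeasurable ?_)
      (.of_forall fun t ↦ ?_)
    · refine continuous_iff_continuousAt.2 fun t ↦ ?_
      have h1 : DifferentiableAt ℂ H (σ + t * I) := by
        have hd1 : DifferentiableAt ℂ (logDeriv riemannZeta₁) (σ + t * I) := by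
          rw [logDeriv]
          exact ((differentiable_riemannZeta₁.contDiff (n := 2)).differentiable_deriv_two _).div
            (differentiable_riemannZeta₁ _)
            (riemannZeta₁_ne_zero_of_one_le_re (by simpa using hσ1.le))
        refine (hd1.neg.mul ?_).mul ?_
        · exact (differentiableAt_id).const_cpow (.inl (by exact_mod_cast hx0.ne'))
        · exact (differentiableAt_const _).div (by fun_prop)
            (verticalLine_ne_zero (by linarith) t)
      exact h1.continuousAt.comp (f := fun t : ℝ ↦ (σ : ℂ) + t * I) (by fun_prop)
    · refine (hHbd (by linarith) hσ2 (by simpa using hreg' t)).trans ?_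
      have := one_add_sq_rpow_le t
      gcongr
  have htail : ‖∫ t in (Set.Ioc (-T) T)ᶜ, H (σ + t * I)‖ ≤ 8 * C * (Real.exp 1 * x) * D * J := by
    refine (norm_integral_le_of_norm_le (g := fun t ↦ 8 * C * (Real.exp 1 * x) * D * v t)
      (hvint.const_mul _).integrableOn ?_).trans ?_
    · refine (ae_restrict_iff' measurableSet_Ioc.compl).2 (.of_forall fun t ht ↦ ?_)
      have h1 : T ≤ |t| := by
        by_contra! hcon
        exact ht ⟨(abs_lt.1 hcon).1, (abs_lt.1 hcon).2.le⟩
      refine (hHbd (by linarith) hσ2 (by simpa using hreg' t)).trans ?_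
      rw [hxσ, mul_assoc (8 * C * (Real.exp 1 * x))]
      gcongr
      exact (one_add_sq_rpow_le_of_le_abs hT0 h1).trans (by gcongr)
    · rw [← integral_const_mul]
      exact setIntegral_le_integral (hvint.const_mul _)
        (.of_forall fun t ↦ mul_nonneg (by positivity) (hv0 t))
  have hright : ‖∫ t : ℝ in (-T)..T, H (σ + t * I)‖ ≤
      8 * C * (x * D) * J + 8 * C * (Real.exp 1 * x) * D * 4 := by
    have h1 : I • ∫ t : ℝ in (-T)..T, H (σ + t * I) =
        I • (∫ t : ℝ in (-T)..T, H ((1 - b : ℝ) + t * I)) +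
          ((∫ a : ℝ in (1 - b)..σ, H (a + T * I)) -
            ∫ a : ℝ in (1 - b)..σ, H (a + (-T : ℝ) * I)) := by
      linear_combination hrect
    have h2 := congrArg norm h1
    rw [norm_smul, norm_I, one_mul] at h2
    rw [h2]
    refine (norm_add_le _ _).trans (add_le_add ?_ ((norm_sub_le _ _).trans ?_))
    · rw [norm_smul, norm_I, one_mul]
      exact hleft
    · have h3 := hcorner T (abs_of_pos hT0)
      have h4 := hcorner (-T) (by rw [abs_neg, abs_of_pos hT0])
      linarith
  have hfinal := integral_logDeriv_riemannZeta₁ (x := x) (by linarith) hσ1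
  have hsplit : ∫ t : ℝ, H (σ + t * I) =
      (∫ t : ℝ in (-T)..T, H (σ + t * I)) + ∫ t in (Set.Ioc (-T) T)ᶜ, H (σ + t * I) := by
    rw [intervalIntegral.integral_of_le (by linarith), integral_add_compl measurableSet_Ioc hHint]
  have hnorm : ‖∫ t : ℝ, H (σ + t * I)‖ ≤ 8 * C * Real.exp 1 * (2 * J + 4) * x * D := by
    rw [hsplit]
    refine (norm_add_le _ _).trans ((add_le_add hright htail).trans ?_)
    have h1 : 8 * C * (x * D) * J ≤ Real.exp 1 * (8 * C * (x * D) * J) :=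
      le_mul_of_one_le_left (by positivity) (Real.one_le_exp (by norm_num))
    linarith
  rw [← Real.norm_eq_abs, ← norm_real, hfinal, norm_smul, Real.norm_of_nonneg (by positivity)]
  refine (mul_le_of_le_one_left (norm_nonneg _) ?_).trans hnorm
  rw [div_le_one (by positivity)]
  linarith [Real.pi_gt_three]

end ContourShift

section PrimeNumberTheorem

open ArithmeticFunction Chebyshev

lemma sqrt_log_half_ge {x : ℝ} (hx : 2 ≤ x) :
    Real.sqrt (Real.log x) - 1 ≤ Real.sqrt (Real.log (x / 2)) := by
  have h2 : Real.log x = Real.log (x / 2) + Real.log 2 := by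
    rw [← Real.log_mul (by positivity) (by norm_num)]; congr 1; ring
  have h0 : 0 ≤ Real.log (x / 2) := Real.log_nonneg (by linarith)
  have : Real.sqrt (Real.log x) ≤ Real.sqrt (Real.log (x / 2)) + 1 := by
    rw [Real.sqrt_le_left (by positivity), h2]
    nlinarith [Real.sq_sqrt h0, Real.sqrt_nonneg (Real.log (x / 2)), Real.log_two_lt_d9]
  linarith

lemma one_le_log_of_three_le {x : ℝ} (hx : 3 ≤ x) : 1 ≤ Real.log x := by
  rw [Real.le_log_iff_exp_le (by linarith)]
  linarith [Real.exp_one_lt_d9]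

lemma sqrt_log_le_log {x : ℝ} (hx : 3 ≤ x) : Real.sqrt (Real.log x) ≤ Real.log x := by
  have h := one_le_log_of_three_le hx
  rw [Real.sqrt_le_left (by linarith)]
  nlinarith

/-- The integral of the Chebyshev function `ψ` over `[0, x]`, as a weighted sum. -/
noncomputable def psiIntegral (x : ℝ) : ℝ := ∑ n ∈ Ioc 0 ⌊x⌋₊, vonMangoldt n * (x - n)

lemma psiIntegral_sub_le {x y : ℝ} (hx : 0 ≤ x) (hxy : x ≤ y) :
    psiIntegral y - psiIntegral x ≤ (y - x) * ψ y := by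
  have hsub : Ioc 0 ⌊x⌋₊ ⊆ Ioc 0 ⌊y⌋₊ := Ioc_subset_Ioc_right (Nat.floor_mono hxy)
  have h1 : ∑ n ∈ Ioc 0 ⌊y⌋₊, vonMangoldt n * (x - n) ≤ psiIntegral x := by
    rw [psiIntegral, ← Finset.sum_sdiff hsub]
    refine add_le_of_nonpos_left (Finset.sum_nonpos fun n hn ↦ ?_)
    simp only [mem_sdiff, mem_Ioc, not_and, not_le] at hn
    have := (Nat.floor_lt hx).1 (hn.2 hn.1.1)
    exact mul_nonpos_of_nonneg_of_nonpos vonMangoldt_nonneg (by linarith)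
  calc psiIntegral y - psiIntegral x
      ≤ psiIntegral y - ∑ n ∈ Ioc 0 ⌊y⌋₊, vonMangoldt n * (x - n) := by linarith
    _ = (y - x) * ψ y := by
      rw [psiIntegral, psi, ← Finset.sum_sub_distrib, Finset.mul_sum]
      exact Finset.sum_congr rfl fun n _ ↦ by ring

lemma le_psiIntegral_sub {x y : ℝ} (hx : 0 ≤ x) (hxy : x ≤ y) :
    (y - x) * ψ x ≤ psiIntegral y - psiIntegral x := by
  have hsub : Ioc 0 ⌊x⌋₊ ⊆ Ioc 0 ⌊y⌋₊ := Ioc_subset_Ioc_right (Nat.floor_mono hxy)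
  have h1 : ∑ n ∈ Ioc 0 ⌊x⌋₊, vonMangoldt n * (y - n) ≤ psiIntegral y := by
    refine Finset.sum_le_sum_of_subset_of_nonneg hsub fun n hn _ ↦ ?_
    have := (Nat.le_floor_iff (hx.trans hxy)).1 (mem_Ioc.1 hn).2
    exact mul_nonneg vonMangoldt_nonneg (by linarith)
  have h2 : (y - x) * ψ x = ∑ n ∈ Ioc 0 ⌊x⌋₊, vonMangoldt n * (y - n) - psiIntegral x := by
    rw [psiIntegral, psi, ← Finset.sum_sub_distrib, Finset.mul_sum]
    exact Finset.sum_congr rfl fun n _ ↦ by ring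
  linarith

lemma exists_abs_psiIntegral_sub_le : ∃ c > 0, c ≤ 1 ∧ ∃ C > 0, ∀ x : ℝ, 3 ≤ x →
    |psiIntegral x - x ^ 2 / 2| ≤ C * x ^ 2 * Real.exp (-c * Real.sqrt (Real.log x)) := by
  obtain ⟨c, hc, C, hC, h⟩ := exists_abs_sum_vonMangoldt_mul_one_sub_le
  refine ⟨min c 1, lt_min hc one_pos, min_le_right _ _, C + 1, by positivity, fun x hx ↦ ?_⟩
  have hx0 : 0 < x := by linarith
  have h1 : Real.exp (-c * Real.sqrt (Real.log x)) ≤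
      Real.exp (-(min c 1) * Real.sqrt (Real.log x)) := by
    gcongr; exact min_le_left _ _
  have h2 : 1 ≤ x * Real.exp (-(min c 1) * Real.sqrt (Real.log x)) := by
    rw [show x * Real.exp (-(min c 1) * Real.sqrt (Real.log x)) =
      Real.exp (Real.log x + -(min c 1) * Real.sqrt (Real.log x)) by
        rw [Real.exp_add, Real.exp_log hx0]]
    refine Real.one_le_exp ?_
    have := sqrt_log_le_log hx
    have := mul_le_mul_of_nonneg_right (min_le_right c 1) (Real.sqrt_nonneg (Real.log x))
    linarith
  have h3 : psiIntegral x = x * ∑ n ∈ Icc 1 ⌊x⌋₊, vonMangoldt n * (1 - n / x) := by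
    rw [psiIntegral, Finset.mul_sum]
    refine Finset.sum_congr rfl fun n _ ↦ ?_
    field_simp
  set S := ∑ n ∈ Icc 1 ⌊x⌋₊, vonMangoldt n * (1 - n / x)
  set D := Real.exp (-(min c 1) * Real.sqrt (Real.log x))
  have h4 : psiIntegral x - x ^ 2 / 2 = x * (S - (x - 1) ^ 2 / (2 * x)) + (1 / 2 - x) := by
    rw [h3]; field_simp; ring
  rw [h4]
  refine (abs_add_le _ _).trans ?_
  have h5 : |x * (S - (x - 1) ^ 2 / (2 * x))| ≤ C * x ^ 2 * D := by
    rw [abs_mul, abs_of_pos hx0]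
    calc _ ≤ x * (C * x * D) := by
          gcongr; exact (h x hx).trans (by gcongr)
      _ = _ := by ring
  have h6 : |1 / 2 - x| ≤ x ^ 2 * D := by
    rw [abs_le]
    constructor <;> nlinarith
  linarith

lemma exists_abs_psi_sub_le : ∃ c > 0, c ≤ 1 / 2 ∧ ∃ C > 0, ∀ x : ℝ, 3 ≤ x →
    |ψ x - x| ≤ C * x * Real.exp (-c * Real.sqrt (Real.log x)) := by
  obtain ⟨c, hc, hc1, C, hC, h⟩ := exists_abs_psiIntegral_sub_le
  have hlarge : ∀ x : ℝ, 6 ≤ x →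
      |ψ x - x| ≤ (1 + 8 * C) * x * Real.exp (-(c / 2) * Real.sqrt (Real.log x)) := by
    intro x hx
    set d := Real.exp (-(c / 2) * Real.sqrt (Real.log x)) with hd
    have hd0 : 0 < d := Real.exp_pos _
    have hd1 : d ≤ 1 := Real.exp_le_one_iff.2 (by
      have := Real.sqrt_nonneg (Real.log x); nlinarith)
    have hdd : d ^ 2 = Real.exp (-c * Real.sqrt (Real.log x)) := by
      rw [hd, ← Real.exp_nat_mul]; congr 1; push_cast; ring
    have hx0 : 0 < x := by linarith
    set k := x * d / 2 with hk
    have hk0 : 0 < k := by positivity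
    have hkx : k ≤ x / 2 := by nlinarith
    have e0 := abs_le.1 (h x (by linarith))
    have e1 := abs_le.1 (h (x + k) (by linarith))
    have e2 := abs_le.1 (h (x - k) (by linarith))
    have d1 : Real.exp (-c * Real.sqrt (Real.log (x + k))) ≤ d ^ 2 := by
      rw [hdd, Real.exp_le_exp, neg_mul, neg_mul, neg_le_neg_iff]
      gcongr; linarith
    have d2 : Real.exp (-c * Real.sqrt (Real.log (x - k))) ≤ 3 * d ^ 2 := by
      have : Real.exp (-c * Real.sqrt (Real.log (x - k))) ≤ Real.exp 1 * d ^ 2 := by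
        rw [hdd, ← Real.exp_add, Real.exp_le_exp]
        have s1 := sqrt_log_half_ge (x := x) (by linarith)
        have s2 : Real.sqrt (Real.log (x / 2)) ≤ Real.sqrt (Real.log (x - k)) := by
          gcongr; linarith
        nlinarith
      nlinarith [Real.exp_one_lt_d9, sq_nonneg d]
    rw [← hdd] at e0
    have b1 : C * (x + k) ^ 2 * Real.exp (-c * Real.sqrt (Real.log (x + k))) ≤
        C * (3 / 2 * x) ^ 2 * d ^ 2 := by
      gcongr; linarith
    have b2 : C * (x - k) ^ 2 * Real.exp (-c * Real.sqrt (Real.log (x - k))) ≤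
        C * x ^ 2 * (3 * d ^ 2) := by
      gcongr
      · linarith
      · linarith
    have u1 := le_psiIntegral_sub hx0.le (by linarith : x ≤ x + k)
    have u2 := psiIntegral_sub_le (by linarith : 0 ≤ x - k) (by linarith : x - k ≤ x)
    have hxd : x * d = 2 * k := by rw [hk]; ring
    have hq : C * x ^ 2 * d ^ 2 = 4 * C * k ^ 2 := by
      rw [mul_assoc, ← mul_pow, hxd]; ring
    have hCk := mul_pos hC hk0
    rw [show (1 + 8 * C) * x * d = (1 + 8 * C) * (2 * k) by rw [← hxd]; ring, abs_le]
    constructor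
    · have : k * (-((1 + 8 * C) * (2 * k))) ≤ k * (ψ x - x) := by
        nlinarith
      exact le_of_mul_le_mul_left this hk0
    · have : k * (ψ x - x) ≤ k * ((1 + 8 * C) * (2 * k)) := by
        nlinarith
      exact le_of_mul_le_mul_left this hk0
  refine ⟨c / 2, by positivity, by linarith, (1 + 8 * C) + (ψ 6 + 6) * Real.exp
    (c / 2 * Real.sqrt (Real.log 6)), by have := psi_nonneg 6; positivity, fun x hx ↦ ?_⟩
  have h6 := psi_nonneg 6
  rcases le_total 6 x with h' | h'
  · refine (hlarge x h').trans ?_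
    refine mul_le_mul_of_nonneg_right (mul_le_mul_of_nonneg_right ?_ (by linarith))
      (Real.exp_nonneg _)
    exact le_add_of_nonneg_right (by positivity)
  · have hψ : ψ x ≤ ψ 6 := psi_mono h'
    have h1 : |ψ x - x| ≤ ψ 6 + 6 := by
      have := psi_nonneg x
      rw [abs_le]; constructor <;> linarith
    have h2 : 1 ≤ Real.exp (c / 2 * Real.sqrt (Real.log 6)) *
        Real.exp (-(c / 2) * Real.sqrt (Real.log x)) := by
      rw [← Real.exp_add]
      refine Real.one_le_exp ?_
      have : Real.sqrt (Real.log x) ≤ Real.sqrt (Real.log 6) := by gcongr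
      nlinarith
    set u := Real.exp (c / 2 * Real.sqrt (Real.log 6))
    set v := Real.exp (-(c / 2) * Real.sqrt (Real.log x))
    have hv : 0 < v := Real.exp_pos _
    calc |ψ x - x| ≤ (ψ 6 + 6) * 1 * 1 := by linarith
      _ ≤ (ψ 6 + 6) * (u * v) * x := by gcongr; linarith
      _ ≤ (1 + 8 * C) * x * v + (ψ 6 + 6) * (u * v) * x := le_add_of_nonneg_left (by positivity)
      _ = _ := by ring

/-- The prime number theorem with the classical error term, for the Chebyshev function `θ`. -/
lemma exists_abs_theta_sub_le : ∃ c > 0, c ≤ 1 / 2 ∧ ∃ C > 0, ∀ x : ℝ, 3 ≤ x →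
    |θ x - x| ≤ C * x * Real.exp (-c * Real.sqrt (Real.log x)) := by
  obtain ⟨c, hc, hc1, C, hC, h⟩ := exists_abs_psi_sub_le
  obtain ⟨B, hB⟩ := psi_sub_theta_le_mul_sqrt
  refine ⟨c, hc, hc1, C + |B|, by positivity, fun x hx ↦ ?_⟩
  have h1 : x.sqrt ≤ x * Real.exp (-c * Real.sqrt (Real.log x)) := by
    have hx0 : 0 < x := by linarith
    rw [Real.sqrt_eq_rpow, Real.rpow_def_of_pos hx0]
    nth_rw 2 [← Real.exp_log hx0]
    rw [← Real.exp_add, Real.exp_le_exp]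
    have := sqrt_log_le_log hx
    nlinarith [Real.sqrt_nonneg (Real.log x)]
  have h2 : |θ x - ψ x| ≤ |B| * (x * Real.exp (-c * Real.sqrt (Real.log x))) := by
    rw [abs_sub_comm, abs_of_nonneg (sub_nonneg.2 (theta_le_psi x))]
    exact (hB x).trans (mul_le_mul (le_abs_self B) h1 (Real.sqrt_nonneg _) (abs_nonneg _))
  have := abs_sub_le (θ x) (ψ x) x
  have := h x hx
  linarith

end PrimeNumberTheorem

section PrimeReciprocals

open Chebyshev MeasureTheory

lemma theta_eq_sum_ite (x : ℝ) :
    θ x = ∑ n ∈ Icc 0 ⌊x⌋₊, if n.Prime then Real.log n else 0 := by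
  rw [theta_eq_sum_Icc, sum_filter]

lemma hasDerivAt_inv_mul_log {t : ℝ} (ht : 1 < t) :
    HasDerivAt (fun t ↦ (t * Real.log t)⁻¹) (-(Real.log t + 1) / (t * Real.log t) ^ 2) t := by
  have h0 : t ≠ 0 := by linarith
  have hl : Real.log t ≠ 0 := (Real.log_pos ht).ne'
  refine (((hasDerivAt_id' t).mul (Real.hasDerivAt_log h0)).inv (mul_ne_zero h0 hl)).congr_deriv ?_
  simp [h0]

lemma hasDerivAt_inv_log_sub_log_log {t : ℝ} (ht : 1 < t) :
    HasDerivAt (fun t ↦ (Real.log t)⁻¹ - Real.log (Real.log t))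
      (-(Real.log t + 1) / (t * Real.log t) ^ 2 * t) t := by
  have h0 : t ≠ 0 := by linarith
  have hl : Real.log t ≠ 0 := (Real.log_pos ht).ne'
  refine (((Real.hasDerivAt_log h0).inv hl).sub ((Real.hasDerivAt_log h0).log hl)).congr_deriv ?_
  field_simp
  ring

lemma hasDerivAt_exp_neg_mul_sqrt_log (c : ℝ) {t : ℝ} (ht : 1 < t) :
    HasDerivAt (fun t ↦ Real.exp (-c * Real.sqrt (Real.log t)))
      (-(c / 2) * (Real.exp (-c * Real.sqrt (Real.log t)) / (t * Real.sqrt (Real.log t)))) t := by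
  have h0 : t ≠ 0 := by linarith
  have hl : 0 < Real.log t := Real.log_pos ht
  have hs : Real.sqrt (Real.log t) ≠ 0 := (Real.sqrt_pos.2 hl).ne'
  convert (((Real.hasDerivAt_log h0).sqrt hl.ne').const_mul (-c)).exp using 1
  field_simp

lemma continuousOn_deriv_inv_mul_log {X Y : ℝ} (hX : 3 ≤ X) :
    ContinuousOn (fun t ↦ -(Real.log t + 1) / (t * Real.log t) ^ 2) (Set.Icc X Y) := by
  intro t ht
  have h0 : t ≠ 0 := by linarith [ht.1]
  have hl : Real.log t ≠ 0 := (Real.log_pos (by linarith [ht.1])).ne'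
  have : (t * Real.log t) ^ 2 ≠ 0 := pow_ne_zero _ (mul_ne_zero h0 hl)
  refine ContinuousAt.continuousWithinAt ?_
  fun_prop (disch := assumption)

lemma exists_abs_sum_prime_inv_sub_le : ∃ c > 0, c ≤ 1 / 2 ∧ ∃ C > 0, ∀ X Y : ℝ, 3 ≤ X → X ≤ Y →
    |∑ p ∈ Ioc ⌊X⌋₊ ⌊Y⌋₊ with p.Prime, (p : ℝ)⁻¹ -
      (Real.log (Real.log Y) - Real.log (Real.log X))| ≤
      C * Real.exp (-c * Real.sqrt (Real.log X)) := by
  obtain ⟨c, hc, hc1, C, hC, h⟩ := exists_abs_theta_sub_le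
  refine ⟨c, hc, hc1, 2 * C + 4 * C / c, by positivity, fun X Y hX hXY ↦ ?_⟩
  set g : ℝ → ℝ := fun t ↦ -(Real.log t + 1) / (t * Real.log t) ^ 2 with hg
  have hgc : ContinuousOn g (Set.Icc X Y) := continuousOn_deriv_inv_mul_log hX
  have hd : ∀ t ∈ Set.Icc X Y, HasDerivAt (fun t ↦ (t * Real.log t)⁻¹) (g t) t :=
    fun t ht ↦ hasDerivAt_inv_mul_log (by linarith [ht.1])
  have hgi : IntegrableOn g (Set.Icc X Y) := hgc.integrableOn_Icc
  have hdi : IntegrableOn (deriv fun t : ℝ ↦ (t * Real.log t)⁻¹) (Set.Icc X Y) :=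
    hgi.congr_fun (fun t ht ↦ (hd t ht).deriv.symm) measurableSet_Icc
  have habel := sum_mul_eq_sub_sub_integral_mul (fun n : ℕ ↦ if n.Prime then Real.log n else 0)
    (by linarith : (0 : ℝ) ≤ X) hXY (fun t ht ↦ (hd t ht).differentiableAt) hdi
  simp_rw [← theta_eq_sum_ite] at habel
  have hsum : ∑ p ∈ Ioc ⌊X⌋₊ ⌊Y⌋₊ with p.Prime, (p : ℝ)⁻¹ =
      ∑ n ∈ Ioc ⌊X⌋₊ ⌊Y⌋₊, ((n : ℝ) * Real.log n)⁻¹ * (if n.Prime then Real.log n else 0) := by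
    rw [sum_filter]
    refine sum_congr rfl fun n _ ↦ ?_
    split_ifs with hn
    · have : Real.log n ≠ 0 := (Real.log_pos (mod_cast hn.one_lt)).ne'
      field_simp
    · simp
  have hθi : IntervalIntegrable (fun t ↦ g t * θ t) volume X Y := by
    rw [intervalIntegrable_iff_integrableOn_Icc_of_le hXY]
    simp_rw [theta_eq_sum_ite]
    exact integrableOn_mul_sum_Icc _ (by linarith) hgi
  have hidi : IntervalIntegrable (fun t ↦ g t * t) volume X Y := by
    rw [intervalIntegrable_iff_integrableOn_Icc_of_le hXY]
    exact (hgc.mul continuousOn_id).integrableOn_Icc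
  have hint : ∫ t in Set.Ioc X Y, deriv (fun t : ℝ ↦ (t * Real.log t)⁻¹) t * θ t =
      ((Real.log Y)⁻¹ - Real.log (Real.log Y) - ((Real.log X)⁻¹ - Real.log (Real.log X))) +
        ∫ t in X..Y, g t * (θ t - t) := by
    rw [← intervalIntegral.integral_of_le hXY, ← intervalIntegral.integral_eq_sub_of_hasDerivAt
      (f := fun t ↦ (Real.log t)⁻¹ - Real.log (Real.log t)) (f' := fun t ↦ g t * t) _ hidi]
    · simp_rw [mul_sub]
      rw [intervalIntegral.integral_sub hθi hidi, add_sub_cancel]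
      refine intervalIntegral.integral_congr fun t ht ↦ ?_
      rw [Set.uIcc_of_le hXY] at ht
      simp only [(hd t ht).deriv]
    · intro t ht
      rw [Set.uIcc_of_le hXY] at ht
      exact hasDerivAt_inv_log_sub_log_log (by linarith [ht.1])
  set D : ℝ → ℝ := fun t ↦ Real.exp (-c * Real.sqrt (Real.log t)) with hD
  have hDi : IntervalIntegrable (fun t ↦ -(c / 2) * (D t / (t * Real.sqrt (Real.log t))))
      volume X Y := by
    refine ContinuousOn.intervalIntegrable_of_Icc hXY fun t ht ↦ ?_
    have h0 : t ≠ 0 := by linarith [ht.1]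
    have hl : 0 < Real.log t := (Real.log_pos (by linarith [ht.1]))
    have : t * Real.sqrt (Real.log t) ≠ 0 := mul_ne_zero h0 (Real.sqrt_pos.2 hl).ne'
    refine ContinuousAt.continuousWithinAt ?_
    fun_prop (disch := assumption)
  have hDint : ∫ t in X..Y, -(c / 2) * (D t / (t * Real.sqrt (Real.log t))) = D Y - D X := by
    refine intervalIntegral.integral_eq_sub_of_hasDerivAt (f := D) (fun t ht ↦ ?_) hDi
    rw [Set.uIcc_of_le hXY] at ht
    exact hasDerivAt_exp_neg_mul_sqrt_log c (by linarith [ht.1])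
  have hbound : |∫ t in X..Y, g t * (θ t - t)| ≤ 4 * C / c * D X := by
    have h1 : |∫ t in X..Y, g t * (θ t - t)| ≤
        ∫ t in X..Y, -(4 * C / c) * (-(c / 2) * (D t / (t * Real.sqrt (Real.log t)))) := by
      refine intervalIntegral.norm_integral_le_of_norm_le (f := fun t ↦ g t * (θ t - t)) hXY
        (Filter.Eventually.of_forall fun t ht ↦ ?_) (hDi.const_mul _)
      have ht3 : 3 ≤ t := hX.trans ht.1.le
      have hl := one_le_log_of_three_le ht3
      have ht0 : 0 < t := by linarith
      have hs1 : 0 < Real.sqrt (Real.log t) := Real.sqrt_pos.2 (by linarith)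
      have hg1 : |g t| ≤ 2 / (t ^ 2 * Real.sqrt (Real.log t)) := by
        rw [hg]
        simp only
        rw [abs_div, abs_neg, abs_of_pos (by positivity : 0 < Real.log t + 1),
          abs_of_pos (by positivity : 0 < (t * Real.log t) ^ 2), div_le_div_iff₀ (by positivity)
          (by positivity)]
        calc (Real.log t + 1) * (t ^ 2 * Real.sqrt (Real.log t))
            ≤ (2 * Real.log t) * (t ^ 2 * Real.log t) := by
              gcongr
              · linarith
              · exact sqrt_log_le_log ht3
          _ = _ := by ring
      rw [Real.norm_eq_abs, abs_mul]
      calc |g t| * |θ t - t| ≤ 2 / (t ^ 2 * Real.sqrt (Real.log t)) * (C * t * D t) := by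
            gcongr; exact h t ht3
        _ = _ := by field_simp; ring
    rw [intervalIntegral.integral_const_mul, hDint] at h1
    have : 0 ≤ 4 * C / c * D Y := by positivity
    linarith
  have hpt : ∀ t, X ≤ t → |(t * Real.log t)⁻¹ * θ t - (Real.log t)⁻¹| ≤ C * D X := by
    intro t ht
    have ht3 : 3 ≤ t := hX.trans ht
    have hl := one_le_log_of_three_le ht3
    have ht0 : 0 < t := by linarith
    have : (t * Real.log t)⁻¹ * θ t - (Real.log t)⁻¹ = (t * Real.log t)⁻¹ * (θ t - t) := by
      field_simp
    rw [this, abs_mul, abs_of_pos (by positivity : 0 < (t * Real.log t)⁻¹)]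
    calc (t * Real.log t)⁻¹ * |θ t - t| ≤ (t * 1)⁻¹ * (C * t * D X) := by
          gcongr
          refine (h t ht3).trans ?_
          rw [hD]
          simp only [neg_mul]
          gcongr
      _ = _ := by field_simp
  rw [hsum, habel, hint]
  have e1 := abs_le.1 (hpt X le_rfl)
  have e2 := abs_le.1 (hpt Y hXY)
  have e3 := abs_le.1 hbound
  rw [add_mul, abs_le]
  constructor <;> linarith [e1.1, e1.2, e2.1, e2.2, e3.1, e3.2]

lemma abs_neg_log_one_sub_sub_le {u : ℝ} (h0 : 0 ≤ u) (h1 : u ≤ 1 / 2) :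
    |-Real.log (1 - u) - u| ≤ 2 * u ^ 2 := by
  have h := Real.abs_log_sub_add_sum_range_le (x := u) (by rw [abs_of_nonneg h0]; linarith) 1
  rw [abs_of_nonneg h0] at h
  norm_num at h
  rw [show -Real.log (1 - u) - u = -(u + Real.log (1 - u)) by ring, abs_neg]
  refine h.trans ?_
  rw [div_le_iff₀ (by linarith)]
  nlinarith [sq_nonneg u]

lemma inv_prime_le_half {p : ℕ} (hp : p.Prime) : (p : ℝ)⁻¹ ≤ 1 / 2 := by
  rw [one_div]
  have : (2 : ℝ) ≤ p := mod_cast hp.two_le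
  gcongr

/-- Minus the logarithm of the product in Mertens' third theorem. -/
noncomputable def mertensSum (x : ℝ) : ℝ :=
  ∑ p ∈ Ioc 0 ⌊x⌋₊ with p.Prime, -Real.log (1 - (p : ℝ)⁻¹)

lemma exists_abs_mertensSum_sub_le : ∃ c > 0, ∃ C > 0, ∀ X Y : ℝ, 3 ≤ X → X ≤ Y →
    |mertensSum Y - mertensSum X - (Real.log (Real.log Y) - Real.log (Real.log X))| ≤
      C * Real.exp (-c * Real.sqrt (Real.log X)) := by
  obtain ⟨c, hc, hc1, C, hC, h⟩ := exists_abs_sum_prime_inv_sub_le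
  refine ⟨c, hc, C + 4, by positivity, fun X Y hX hXY ↦ ?_⟩
  have hX0 : 0 < X := by linarith
  have hfl : ⌊X⌋₊ ≤ ⌊Y⌋₊ := Nat.floor_mono hXY
  have h3 : 3 ≤ ⌊X⌋₊ := Nat.le_floor (by exact_mod_cast hX)
  have h1 : mertensSum Y - mertensSum X =
      ∑ p ∈ Ioc ⌊X⌋₊ ⌊Y⌋₊ with p.Prime, -Real.log (1 - (p : ℝ)⁻¹) := by
    rw [mertensSum, mertensSum, sub_eq_iff_eq_add', sum_filter, sum_filter, sum_filter]
    exact (sum_Ioc_consecutive _ (Nat.zero_le _) hfl).symm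
  have h2 : |∑ p ∈ Ioc ⌊X⌋₊ ⌊Y⌋₊ with p.Prime, -Real.log (1 - (p : ℝ)⁻¹) -
      ∑ p ∈ Ioc ⌊X⌋₊ ⌊Y⌋₊ with p.Prime, (p : ℝ)⁻¹| ≤ 2 * (⌊X⌋₊ : ℝ)⁻¹ := by
    rw [← sum_sub_distrib]
    refine (abs_sum_le_sum_abs _ _).trans ?_
    calc _ ≤ ∑ p ∈ Ioc ⌊X⌋₊ ⌊Y⌋₊ with p.Prime, 2 * ((p : ℝ) ^ 2)⁻¹ :=
          sum_le_sum fun p hp ↦ (abs_neg_log_one_sub_sub_le (by positivity)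
            (inv_prime_le_half (mem_filter.1 hp).2)).trans_eq (by rw [inv_pow])
      _ ≤ ∑ p ∈ Ioc ⌊X⌋₊ ⌊Y⌋₊, 2 * ((p : ℝ) ^ 2)⁻¹ :=
          sum_le_sum_of_subset_of_nonneg (filter_subset _ _) fun _ _ _ ↦ by positivity
      _ = 2 * ∑ p ∈ Ioc ⌊X⌋₊ ⌊Y⌋₊, ((p : ℝ) ^ 2)⁻¹ := by rw [mul_sum]
      _ ≤ 2 * (⌊X⌋₊ : ℝ)⁻¹ := by
          gcongr
          refine (sum_Ioc_inv_sq_le_sub (by omega) hfl).trans ?_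
          simp
  have h4 : (⌊X⌋₊ : ℝ)⁻¹ ≤ 2 * Real.exp (-c * Real.sqrt (Real.log X)) := by
    have hf : X / 2 ≤ ⌊X⌋₊ := by have := Nat.lt_floor_add_one X; linarith
    calc (⌊X⌋₊ : ℝ)⁻¹ ≤ (X / 2)⁻¹ := by gcongr
      _ = 2 * Real.exp (-Real.log X) := by rw [Real.exp_neg, Real.exp_log hX0]; field_simp
      _ ≤ _ := by
        gcongr
        have := sqrt_log_le_log hX
        nlinarith [Real.sqrt_nonneg (Real.log X)]
  rw [h1]
  have e1 := abs_le.1 (h X Y hX hXY)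
  have e2 := abs_le.1 h2
  rw [abs_le]
  constructor <;> linarith [e1.1, e1.2, e2.1, e2.2]

end PrimeReciprocals

section MertensConstant

open Filter Topology

lemma exists_abs_mertensSum_sub_log_log_sub_le : ∃ L : ℝ, ∃ c > 0, ∃ C > 0, ∀ X : ℝ, 3 ≤ X →
    |mertensSum X - Real.log (Real.log X) - L| ≤ C * Real.exp (-c * Real.sqrt (Real.log X)) := by
  obtain ⟨c, hc, C, hC, h⟩ := exists_abs_mertensSum_sub_le
  set u : ℕ → ℝ := fun N ↦ mertensSum (Real.exp (N + 2)) - Real.log (N + 2) with hu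
  have hexp : ∀ N : ℕ, 3 ≤ Real.exp ((N : ℝ) + 2) := fun N ↦ by
    have := Real.add_one_le_exp ((N : ℝ) + 2)
    have := N.cast_nonneg (α := ℝ)
    linarith
  have hle : ∀ N n : ℕ, N ≤ n → |u n - u N| ≤ C * Real.exp (-c * Real.sqrt (N + 2)) := by
    intro N n hNn
    have := h (Real.exp (N + 2)) (Real.exp (n + 2)) (hexp N) (by gcongr)
    rw [Real.log_exp, Real.log_exp] at this
    rw [hu]
    convert this using 2
    ring
  have hlim : Tendsto (fun N : ℕ ↦ 2 * C * Real.exp (-c * Real.sqrt (N + 2))) atTop (𝓝 0) := by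
    rw [← mul_zero (2 * C)]
    refine Tendsto.const_mul _ (Real.tendsto_exp_atBot.comp ?_)
    refine Tendsto.const_mul_atTop_of_neg (by linarith) (Real.tendsto_sqrt_atTop.comp ?_)
    exact tendsto_atTop_add_const_right _ _ tendsto_natCast_atTop_atTop
  have hcauchy : CauchySeq u := by
    refine cauchySeq_of_le_tendsto_0 _ (fun n m N hn hm ↦ ?_) hlim
    have h1 := hle N n hn
    have h2 := hle N m hm
    rw [abs_sub_comm] at h2
    rw [Real.dist_eq]
    have := abs_sub_le (u n) (u N) (u m)
    linarith
  obtain ⟨L, hL⟩ := cauchySeq_tendsto_of_complete hcauchy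
  refine ⟨L, c, hc, C, hC, fun X hX ↦ ?_⟩
  have hev : ∀ᶠ N : ℕ in atTop, |mertensSum X - Real.log (Real.log X) - u N| ≤
      C * Real.exp (-c * Real.sqrt (Real.log X)) := by
    filter_upwards [eventually_ge_atTop ⌈X⌉₊] with N hN
    have hXN : X ≤ Real.exp ((N : ℝ) + 2) := by
      have := Real.add_one_le_exp ((N : ℝ) + 2)
      have := Nat.le_of_ceil_le hN
      linarith
    have := h X _ hX hXN
    rw [Real.log_exp] at this
    rw [abs_sub_comm, hu]
    convert this using 2
    ring
  exact le_of_tendsto ((tendsto_const_nhds.sub hL).abs) hev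

lemma neg_log_one_sub_inv_prime_nonneg {p : ℕ} (hp : p.Prime) : 0 ≤ -Real.log (1 - (p : ℝ)⁻¹) := by
  have h1 := inv_prime_le_half hp
  have h2 : (0 : ℝ) ≤ (p : ℝ)⁻¹ := by positivity
  exact neg_nonneg.2 (Real.log_nonpos (by linarith) (by linarith))

lemma neg_log_one_sub_inv_prime_le {p : ℕ} (hp : p.Prime) :
    -Real.log (1 - (p : ℝ)⁻¹) ≤ 2 * (p : ℝ)⁻¹ := by
  have h1 := inv_prime_le_half hp
  have h2 : (0 : ℝ) ≤ (p : ℝ)⁻¹ := by positivity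
  have h3 := (abs_le.1 (abs_neg_log_one_sub_sub_le h2 h1)).2
  nlinarith

lemma summable_neg_log_mul_rpow {δ : ℝ} (hδ : 0 < δ) :
    Summable fun p : Nat.Primes ↦ -Real.log (1 - (p : ℝ)⁻¹) * (p : ℝ) ^ (-δ) := by
  refine Summable.of_nonneg_of_le (fun p ↦ ?_) (fun p ↦ ?_)
    ((Nat.Primes.summable_rpow (r := -1 - δ)).2 (by linarith) |>.mul_left 2)
  · exact mul_nonneg (neg_log_one_sub_inv_prime_nonneg p.2) (by positivity)
  · have hp : (0 : ℝ) < p := mod_cast p.2.pos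
    rw [show -1 - δ = -1 + -δ by ring, Real.rpow_add hp, Real.rpow_neg_one, ← mul_assoc]
    gcongr
    exact neg_log_one_sub_inv_prime_le p.2

lemma exp_neg_pow_ceil_log_le {n : ℕ} (hn : 0 < n) {δ : ℝ} (hδ : 0 < δ) :
    Real.exp (-δ) ^ ⌈Real.log n⌉₊ ≤ (n : ℝ) ^ (-δ) := by
  rw [← Real.exp_nat_mul, Real.rpow_def_of_pos (by exact_mod_cast hn), Real.exp_le_exp]
  nlinarith [Nat.le_ceil (Real.log n)]

lemma le_exp_neg_pow_ceil_log {n : ℕ} (hn : 0 < n) {δ : ℝ} (hδ : 0 < δ) :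
    Real.exp (-δ) * (n : ℝ) ^ (-δ) ≤ Real.exp (-δ) ^ ⌈Real.log n⌉₊ := by
  rw [← Real.exp_nat_mul, Real.rpow_def_of_pos (by exact_mod_cast hn), ← Real.exp_add,
    Real.exp_le_exp]
  have := Nat.ceil_lt_add_one (Real.log_natCast_nonneg n)
  nlinarith

lemma summable_neg_log_mul_exp_pow {δ : ℝ} (hδ : 0 < δ) :
    Summable fun p : Nat.Primes ↦
      -Real.log (1 - (p : ℝ)⁻¹) * Real.exp (-δ) ^ ⌈Real.log (p : ℕ)⌉₊ := by
  refine Summable.of_nonneg_of_le (fun p ↦ ?_) (fun p ↦ ?_) (summable_neg_log_mul_rpow hδ)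
  · exact mul_nonneg (neg_log_one_sub_inv_prime_nonneg p.2) (by positivity)
  · exact mul_le_mul_of_nonneg_left (exp_neg_pow_ceil_log_le p.2.pos hδ)
      (neg_log_one_sub_inv_prime_nonneg p.2)

lemma tsum_neg_log_one_sub_eq_log_riemannZeta {δ : ℝ} (hδ : 0 < δ) :
    ∑' p : Nat.Primes, -Real.log (1 - (p : ℝ) ^ (-(1 + δ))) =
      Real.log (riemannZeta ((1 + δ : ℝ) : ℂ)).re := by
  have h := riemannZeta_eulerProduct_exp_log (s := ((1 + δ : ℝ) : ℂ)) (by simp [hδ])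
  have h1 : ∀ p : Nat.Primes, -Complex.log (1 - (p : ℂ) ^ (-((1 + δ : ℝ) : ℂ))) =
      ((-Real.log (1 - (p : ℝ) ^ (-(1 + δ))) : ℝ) : ℂ) := by
    intro p
    have hp : (1 : ℝ) < p := mod_cast p.2.one_lt
    have h2 : (p : ℝ) ^ (-(1 + δ)) ≤ 1 := Real.rpow_le_one_of_one_le_of_nonpos hp.le (by linarith)
    rw [Complex.ofReal_neg, Complex.ofReal_log (by linarith), Complex.ofReal_sub,
      Complex.ofReal_cpow (by linarith), Complex.ofReal_neg]
    simp
  simp_rw [h1] at h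
  rw [← Complex.ofReal_tsum, ← Complex.ofReal_exp] at h
  rw [← h, Complex.ofReal_re, Real.log_exp]

lemma tendsto_one_add_nhdsGT : Tendsto (fun δ : ℝ ↦ 1 + δ) (𝓝[>] 0) (𝓝[>] 1) := by
  refine tendsto_nhdsWithin_iff.2 ⟨?_, ?_⟩
  · have : Tendsto (fun δ : ℝ ↦ 1 + δ) (𝓝 0) (𝓝 (1 + 0)) :=
      (by fun_prop : Continuous fun δ : ℝ ↦ 1 + δ).tendsto 0
    rw [add_zero] at this
    exact this.mono_left nhdsWithin_le_nhds
  · filter_upwards [self_mem_nhdsWithin] with δ hδ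
    simpa using hδ

lemma tendsto_log_riemannZeta_add_log :
    Tendsto (fun δ : ℝ ↦ Real.log (riemannZeta ((1 + δ : ℝ) : ℂ)).re + Real.log δ)
      (𝓝[>] 0) (𝓝 0) := by
  have h := (Asymptotics.isLittleO_one_iff ℝ).1 log_riemannZeta_add_log_sub_isLittleO_ofReal
  refine (h.comp tendsto_one_add_nhdsGT).congr fun δ ↦ ?_
  simp [Function.comp]

lemma tendsto_tsum_neg_log_sub :
    Tendsto (fun δ : ℝ ↦ ∑' p : Nat.Primes, (-Real.log (1 - (p : ℝ) ^ (-(1 + δ))) -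
      -Real.log (1 - (p : ℝ)⁻¹) * (p : ℝ) ^ (-δ))) (𝓝[>] 0) (𝓝 0) := by
  have h := tendsto_tsum_of_dominated_convergence (𝓕 := 𝓝[>] (0 : ℝ))
    (f := fun (δ : ℝ) (p : Nat.Primes) ↦ (-Real.log (1 - (p : ℝ) ^ (-(1 + δ))) -
      -Real.log (1 - (p : ℝ)⁻¹) * (p : ℝ) ^ (-δ))) (g := fun _ ↦ 0)
    (bound := fun p : Nat.Primes ↦ 4 * (p : ℝ) ^ (-2 : ℝ))
    ((Nat.Primes.summable_rpow.2 (by norm_num)).mul_left 4) (fun p ↦ ?_) ?_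
  · simpa using h
  · have hp : (p : ℝ) ≠ 0 := mod_cast p.2.ne_zero
    have h1 := inv_prime_le_half p.2
    have hne : 1 - (p : ℝ) ^ (-(1 + (0 : ℝ))) ≠ 0 := by
      rw [add_zero, Real.rpow_neg_one]; linarith
    have hc : ContinuousAt (fun δ : ℝ ↦ -Real.log (1 - (p : ℝ) ^ (-(1 + δ))) -
      -Real.log (1 - (p : ℝ)⁻¹) * (p : ℝ) ^ (-δ)) 0 := by
      have h2 : ContinuousAt (fun δ : ℝ ↦ (p : ℝ) ^ (-(1 + δ))) 0 := by
        fun_prop (disch := simp [hp])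
      have h3 : ContinuousAt (fun δ : ℝ ↦ (p : ℝ) ^ (-δ)) 0 := by
        fun_prop (disch := simp [hp])
      exact (((continuousAt_const.sub h2).log hne).neg).sub (continuousAt_const.mul h3)
    have h4 := hc.tendsto
    rw [add_zero, Real.rpow_neg_one, neg_zero, Real.rpow_zero, mul_one, sub_self] at h4
    exact h4.mono_left nhdsWithin_le_nhds
  · filter_upwards [self_mem_nhdsWithin] with δ hδ p
    have hδ' : 0 < δ := hδ
    have hp : (1 : ℝ) < p := mod_cast p.2.one_lt
    have h1 := inv_prime_le_half p.2
    have h0 : (0 : ℝ) ≤ (p : ℝ)⁻¹ := by positivity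
    have hv0 : 0 ≤ (p : ℝ) ^ (-δ) := by positivity
    have hv1 : (p : ℝ) ^ (-δ) ≤ 1 := Real.rpow_le_one_of_one_le_of_nonpos hp.le (by linarith)
    have hu : (p : ℝ) ^ (-(1 + δ)) = (p : ℝ)⁻¹ * (p : ℝ) ^ (-δ) := by
      rw [neg_add, Real.rpow_add (by linarith), Real.rpow_neg_one]
    have hsq : (p : ℝ) ^ (-2 : ℝ) = (p : ℝ)⁻¹ ^ 2 := by
      rw [Real.rpow_neg (by linarith), Real.rpow_two, inv_pow]
    rw [hu, hsq, Real.norm_eq_abs]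
    set v := (p : ℝ) ^ (-δ)
    set w := (p : ℝ)⁻¹
    have hwv : w * v ≤ w := mul_le_of_le_one_right h0 hv1
    have e1 := abs_neg_log_one_sub_sub_le (mul_nonneg h0 hv0) (hwv.trans h1)
    have e2 := abs_neg_log_one_sub_sub_le h0 h1
    have e3 : |(-Real.log (1 - w) - w) * v| ≤ 2 * w ^ 2 := by
      rw [abs_mul, abs_of_nonneg hv0]
      exact (mul_le_of_le_one_right (abs_nonneg _) hv1).trans e2
    have e4 : (w * v) ^ 2 ≤ w ^ 2 := by gcongr
    rw [show -Real.log (1 - w * v) - -Real.log (1 - w) * v =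
      (-Real.log (1 - w * v) - w * v) - (-Real.log (1 - w) - w) * v by ring]
    refine (abs_sub _ _).trans ?_
    linarith

lemma summable_neg_log_one_sub_rpow {δ : ℝ} (hδ : 0 < δ) :
    Summable fun p : Nat.Primes ↦ -Real.log (1 - (p : ℝ) ^ (-(1 + δ))) := by
  refine Summable.of_nonneg_of_le (fun p ↦ ?_) (fun p ↦ ?_)
    ((Nat.Primes.summable_rpow (r := -(1 + δ))).2 (by linarith) |>.mul_left 2)
  all_goals
    have hp : (1 : ℝ) < p := mod_cast p.2.one_lt
    have h1 := inv_prime_le_half p.2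
    have h0 : 0 < (p : ℝ) ^ (-(1 + δ)) := by positivity
    have h2 : (p : ℝ) ^ (-(1 + δ)) ≤ 1 / 2 := by
      refine le_trans ?_ h1
      rw [← Real.rpow_neg_one]
      exact Real.rpow_le_rpow_of_exponent_le hp.le (by linarith)
  · exact neg_nonneg.2 (Real.log_nonpos (by linarith) (by linarith))
  · have h3 := (abs_le.1 (abs_neg_log_one_sub_sub_le h0.le h2)).2
    nlinarith

lemma tendsto_tsum_neg_log_mul_rpow_add_log :
    Tendsto (fun δ : ℝ ↦ ∑' p : Nat.Primes, -Real.log (1 - (p : ℝ)⁻¹) * (p : ℝ) ^ (-δ) +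
      Real.log δ) (𝓝[>] 0) (𝓝 0) := by
  have h := tendsto_log_riemannZeta_add_log.sub tendsto_tsum_neg_log_sub
  rw [sub_zero] at h
  refine h.congr' ?_
  filter_upwards [self_mem_nhdsWithin] with δ hδ
  rw [(summable_neg_log_one_sub_rpow hδ).tsum_sub (summable_neg_log_mul_rpow hδ),
    tsum_neg_log_one_sub_eq_log_riemannZeta hδ]
  ring

lemma tendsto_tsum_neg_log_mul_exp_pow_add_log :
    Tendsto (fun δ : ℝ ↦ ∑' p : Nat.Primes,
      -Real.log (1 - (p : ℝ)⁻¹) * Real.exp (-δ) ^ ⌈Real.log (p : ℕ)⌉₊ + Real.log δ)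
      (𝓝[>] 0) (𝓝 0) := by
  set G : ℝ → ℝ := fun δ ↦ ∑' p : Nat.Primes, -Real.log (1 - (p : ℝ)⁻¹) * (p : ℝ) ^ (-δ) with hG
  have hlim : Tendsto (fun δ : ℝ ↦ G δ + Real.log δ) (𝓝[>] 0) (𝓝 0) :=
    tendsto_tsum_neg_log_mul_rpow_add_log
  have hid : Tendsto (fun δ : ℝ ↦ δ) (𝓝[>] 0) (𝓝 0) := tendsto_id.mono_left nhdsWithin_le_nhds
  have hlog : Tendsto (fun δ : ℝ ↦ Real.log δ * δ) (𝓝[>] 0) (𝓝 0) := by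
    simpa using tendsto_log_mul_rpow_nhdsGT_zero one_pos
  have hlow : Tendsto (fun δ : ℝ ↦ (G δ + Real.log δ) - ((G δ + Real.log δ) * δ - Real.log δ * δ))
      (𝓝[>] 0) (𝓝 0) := by
    simpa using hlim.sub ((hlim.mul hid).sub hlog)
  refine tendsto_of_tendsto_of_tendsto_of_le_of_le' hlow hlim ?_ ?_
  · filter_upwards [self_mem_nhdsWithin] with δ hδ
    have hG0 : 0 ≤ G δ := tsum_nonneg fun p ↦
      mul_nonneg (neg_log_one_sub_inv_prime_nonneg p.2) (by positivity)
    have h1 : Real.exp (-δ) * G δ ≤ ∑' p : Nat.Primes,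
        -Real.log (1 - (p : ℝ)⁻¹) * Real.exp (-δ) ^ ⌈Real.log (p : ℕ)⌉₊ := by
      rw [hG, ← tsum_mul_left]
      refine Summable.tsum_le_tsum (fun p ↦ ?_) ((summable_neg_log_mul_rpow hδ).mul_left _)
        (summable_neg_log_mul_exp_pow hδ)
      rw [mul_left_comm]
      exact mul_le_mul_of_nonneg_left (le_exp_neg_pow_ceil_log p.2.pos hδ)
        (neg_log_one_sub_inv_prime_nonneg p.2)
    have h2 := Real.add_one_le_exp (-δ)
    nlinarith
  · filter_upwards [self_mem_nhdsWithin] with δ hδ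
    gcongr
    refine Summable.tsum_le_tsum (fun p ↦ ?_) (summable_neg_log_mul_exp_pow hδ)
      (summable_neg_log_mul_rpow hδ)
    exact mul_le_mul_of_nonneg_left (exp_neg_pow_ceil_log_le p.2.pos hδ)
      (neg_log_one_sub_inv_prime_nonneg p.2)

/-- The sum of `-log (1 - 1 / p)` over the primes `p` with `⌈log p⌉ = m`. -/
noncomputable def mertensBlock (m : ℕ) : ℝ :=
  ∑' p : ((fun p : Nat.Primes ↦ ⌈Real.log (p : ℕ)⌉₊) ⁻¹' {m}), -Real.log (1 - (((p : Nat.Primes) : ℕ) : ℝ)⁻¹)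

lemma mertensBlock_eq_sum {m M : ℕ} (hm : m ≤ M) :
    mertensBlock m = ∑ p ∈ Ioc 0 ⌊Real.exp M⌋₊ with p.Prime,
      if ⌈Real.log p⌉₊ = m then -Real.log (1 - (p : ℝ)⁻¹) else 0 := by
  have hind : ∀ p : Nat.Primes, ((fun p : Nat.Primes ↦ ⌈Real.log (p : ℕ)⌉₊) ⁻¹' {m}).indicator
      (fun p : Nat.Primes ↦ -Real.log (1 - (p : ℝ)⁻¹)) p =
      if ⌈Real.log (p : ℕ)⌉₊ = m then -Real.log (1 - (p : ℝ)⁻¹) else 0 := fun p ↦ by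
    classical exact (Set.indicator_apply _ _ _).trans (if_congr Iff.rfl rfl rfl)
  rw [mertensBlock, _root_.tsum_subtype ((fun p : Nat.Primes ↦ ⌈Real.log (p : ℕ)⌉₊) ⁻¹' {m})
    (fun p : Nat.Primes ↦ -Real.log (1 - (p : ℝ)⁻¹)), tsum_congr hind, ← sum_subtype_eq_sum_filter]
  refine tsum_eq_sum (β := Nat.Primes) fun p hp ↦ if_neg fun hpm ↦ hp ?_
  have hp0 : (0 : ℝ) < (p : ℕ) := mod_cast p.2.pos
  have hM : (m : ℝ) ≤ M := mod_cast hm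
  exact mem_subtype.2 (mem_Ioc.2 ⟨p.2.pos, Nat.le_floor
    ((Real.log_le_iff_le_exp hp0).1 ((Nat.ceil_le.1 hpm.le).trans hM))⟩)

lemma sum_mertensBlock (M : ℕ) :
    ∑ m ∈ range (M + 1), mertensBlock m = mertensSum (Real.exp M) := by
  rw [sum_congr rfl fun m hm ↦ mertensBlock_eq_sum (Nat.lt_succ_iff.1 (mem_range.1 hm)), sum_comm,
    mertensSum]
  refine sum_congr rfl fun p hp ↦ ?_
  have hpr := (mem_filter.1 hp).2
  have hp0 : (0 : ℝ) < p := mod_cast hpr.pos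
  have hle : (p : ℝ) ≤ Real.exp M :=
    (Nat.le_floor_iff (Real.exp_nonneg _)).1 (mem_Ioc.1 (mem_filter.1 hp).1).2
  rw [sum_ite_eq, if_pos]
  rw [mem_range, Nat.lt_succ_iff, Nat.ceil_le]
  exact (Real.log_le_iff_le_exp hp0).2 hle

lemma hasSum_mertensBlock_mul_pow {δ : ℝ} (hδ : 0 < δ) :
    HasSum (fun m ↦ mertensBlock m * Real.exp (-δ) ^ m) (∑' p : Nat.Primes,
      -Real.log (1 - (p : ℝ)⁻¹) * Real.exp (-δ) ^ ⌈Real.log (p : ℕ)⌉₊) := by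
  have hblock : (fun m ↦ mertensBlock m * Real.exp (-δ) ^ m) = fun m ↦
      ∑' p : ((fun p : Nat.Primes ↦ ⌈Real.log (p : ℕ)⌉₊) ⁻¹' {m}),
        -Real.log (1 - (((p : Nat.Primes) : ℕ) : ℝ)⁻¹) *
          Real.exp (-δ) ^ ⌈Real.log ((p : Nat.Primes) : ℕ)⌉₊ := by
    funext m
    rw [mertensBlock, ← tsum_mul_right]
    refine tsum_congr fun p ↦ ?_
    have : ⌈Real.log ((p : Nat.Primes) : ℕ)⌉₊ = m := p.2
    rw [this]
  rw [hblock]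
  exact (summable_neg_log_mul_exp_pow hδ).hasSum.tsum_fiberwise
    (fun p : Nat.Primes ↦ ⌈Real.log (p : ℕ)⌉₊)

lemma hasSum_inv_mul_pow {x : ℝ} (hx : |x| < 1) :
    HasSum (fun m : ℕ ↦ (m : ℝ)⁻¹ * x ^ m) (-Real.log (1 - x)) := by
  rw [← hasSum_nat_add_iff' 1]
  simpa [div_eq_inv_mul] using Real.hasSum_pow_div_log_of_abs_lt_one hx

lemma tendsto_sum_mertensBlock_sub_inv {L : ℝ}
    (hL : Tendsto (fun M : ℕ ↦ mertensSum (Real.exp M) - Real.log M) atTop (𝓝 L)) :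
    Tendsto (fun n ↦ ∑ m ∈ range n, (mertensBlock m - (m : ℝ)⁻¹)) atTop
      (𝓝 (L - Real.eulerMascheroniConstant)) := by
  rw [← tendsto_add_atTop_iff_nat 1]
  refine (hL.sub Real.tendsto_harmonic_sub_log).congr fun M ↦ ?_
  rw [sum_sub_distrib, sum_mertensBlock, sum_range_succ', harmonic]
  push_cast
  simp

lemma tendsto_log_one_sub_exp_neg_sub_log :
    Tendsto (fun δ : ℝ ↦ Real.log (1 - Real.exp (-δ)) - Real.log δ) (𝓝[>] 0) (𝓝 0) := by
  have h1 : HasDerivAt (fun δ : ℝ ↦ 1 - Real.exp (-δ)) 1 0 := by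
    simpa using ((hasDerivAt_neg (0 : ℝ)).exp).const_sub 1
  have h2 := (hasDerivAt_iff_tendsto_slope_zero.1 h1).mono_left
    (nhdsWithin_mono 0 (fun x (hx : 0 < x) ↦ hx.ne'))
  have h3 := h2.log one_ne_zero
  rw [Real.log_one] at h3
  refine h3.congr' ?_
  filter_upwards [self_mem_nhdsWithin] with δ hδ
  have hδ' : 0 < δ := hδ
  have h4 : 0 < 1 - Real.exp (-δ) := sub_pos.2 (Real.exp_lt_one_iff.2 (by linarith))
  simp only [zero_add, neg_zero, Real.exp_zero, sub_self, sub_zero, smul_eq_mul]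
  rw [Real.log_mul (inv_ne_zero hδ'.ne') h4.ne', Real.log_inv]
  ring

lemma eq_eulerMascheroniConstant_of_tendsto {L : ℝ}
    (hL : Tendsto (fun M : ℕ ↦ mertensSum (Real.exp M) - Real.log M) atTop (𝓝 L)) :
    L = Real.eulerMascheroniConstant := by
  have hexp : Tendsto (fun δ : ℝ ↦ Real.exp (-δ)) (𝓝[>] 0) (𝓝[<] 1) := by
    refine tendsto_nhdsWithin_iff.2 ⟨?_, ?_⟩
    · have : Tendsto (fun δ : ℝ ↦ Real.exp (-δ)) (𝓝 0) (𝓝 (Real.exp (-0))) :=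
        (by fun_prop : Continuous fun δ : ℝ ↦ Real.exp (-δ)).tendsto 0
      rw [neg_zero, Real.exp_zero] at this
      exact this.mono_left nhdsWithin_le_nhds
    · filter_upwards [self_mem_nhdsWithin] with δ hδ
      exact Real.exp_lt_one_iff.2 (neg_lt_zero.2 hδ)
  have habel := (Real.tendsto_tsum_powerSeries_nhdsWithin_lt
    (tendsto_sum_mertensBlock_sub_inv hL)).comp hexp
  have hzero : Tendsto (fun δ : ℝ ↦ ∑' m : ℕ, (mertensBlock m - (m : ℝ)⁻¹) * Real.exp (-δ) ^ m)
      (𝓝[>] 0) (𝓝 0) := by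
    have h := tendsto_tsum_neg_log_mul_exp_pow_add_log.add tendsto_log_one_sub_exp_neg_sub_log
    rw [add_zero] at h
    refine h.congr' ?_
    filter_upwards [self_mem_nhdsWithin] with δ hδ
    have hlt : |Real.exp (-δ)| < 1 := by
      rw [abs_of_pos (Real.exp_pos _)]
      exact Real.exp_lt_one_iff.2 (neg_lt_zero.2 hδ)
    have := (hasSum_mertensBlock_mul_pow hδ).sub (hasSum_inv_mul_pow hlt)
    simp_rw [sub_mul]
    rw [this.tsum_eq]
    ring
  exact sub_eq_zero.1 (tendsto_nhds_unique habel hzero)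

/-- Mertens' theorem for `∑ -log (1 - 1 / p)`, with the classical error term. -/
lemma exists_abs_mertensSum_sub_log_log_sub_eulerMascheroniConstant_le :
    ∃ c > 0, ∃ C > 0, ∀ X : ℝ, 3 ≤ X →
      |mertensSum X - Real.log (Real.log X) - Real.eulerMascheroniConstant| ≤
        C * Real.exp (-c * Real.sqrt (Real.log X)) := by
  obtain ⟨L, c, hc, C, hC, h⟩ := exists_abs_mertensSum_sub_log_log_sub_le
  suffices hL : L = Real.eulerMascheroniConstant from hL ▸ ⟨c, hc, C, hC, h⟩
  refine eq_eulerMascheroniConstant_of_tendsto ?_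
  have hlim : Tendsto (fun M : ℕ ↦ C * Real.exp (-c * Real.sqrt M)) atTop (𝓝 0) := by
    rw [← mul_zero C]
    refine Tendsto.const_mul _ (Real.tendsto_exp_atBot.comp ?_)
    exact Tendsto.const_mul_atTop_of_neg (by linarith)
      (Real.tendsto_sqrt_atTop.comp tendsto_natCast_atTop_atTop)
  rw [tendsto_iff_norm_sub_tendsto_zero]
  refine squeeze_zero' (Eventually.of_forall fun _ ↦ norm_nonneg _) ?_ hlim
  filter_upwards [eventually_ge_atTop 2] with M hM
  have hM' : (2 : ℝ) ≤ M := mod_cast hM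
  have := h (Real.exp M) (by linarith [Real.add_one_le_exp (M : ℝ)])
  rwa [Real.log_exp] at this

end MertensConstant

/-- Mertens' third theorem with strengthened error term: there is `K₂ > 0` with
`∏_{p ≤ X} (1 - 1/p) = (e^{-γ}/log X)(1 + O(e^{-K₂ √(log X)}))`. -/
theorem mertens_third_with_error :
    ∃ K₂ > (0 : ℝ), ∃ C > (0 : ℝ), ∀ X : ℝ, 3 ≤ X → ∃ E : ℝ,
      |E| ≤ C * Real.exp (-K₂ * Real.sqrt (Real.log X)) ∧
      (∏ p ∈ (Finset.Icc 1 ⌊X⌋₊).filter Nat.Prime, (1 - (1 : ℝ) / p)) =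
        Real.exp (-Real.eulerMascheroniConstant) / Real.log X * (1 + E) := by
  obtain ⟨c, hc, C, hC, h⟩ := exists_abs_mertensSum_sub_log_log_sub_eulerMascheroniConstant_le
  refine ⟨c, hc, C * Real.exp C, by positivity, fun X hX ↦ ?_⟩
  set r := mertensSum X - Real.log (Real.log X) - Real.eulerMascheroniConstant with hr
  have hl := one_le_log_of_three_le hX
  refine ⟨Real.exp (-r) - 1, ?_, ?_⟩
  · have h1 := h X hX
    have h2 : |r| ≤ C := h1.trans (mul_le_of_le_one_right hC.le (Real.exp_le_one_iff.2 (by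
      nlinarith [Real.sqrt_nonneg (Real.log X)])))
    have h3 : |Real.exp (-r) - 1| ≤ |r| * Real.exp |r| := by
      have e1 := Real.add_one_le_exp (-r)
      have e2 := Real.add_one_le_exp r
      have e3 : 1 ≤ Real.exp |r| := Real.one_le_exp (abs_nonneg _)
      have e4 : Real.exp (-r) ≤ Real.exp |r| := Real.exp_le_exp.2 (neg_le_abs r)
      have e5 : Real.exp (-r) * Real.exp r = 1 := by rw [← Real.exp_add]; simp
      have e6 : 0 < Real.exp (-r) := Real.exp_pos _
      rw [abs_le]
      constructor
      · nlinarith [le_abs_self r, abs_nonneg r]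
      · nlinarith [neg_le_abs r, abs_nonneg r]
    calc |Real.exp (-r) - 1| ≤ |r| * Real.exp |r| := h3
      _ ≤ (C * Real.exp (-c * Real.sqrt (Real.log X))) * Real.exp C := by gcongr
      _ = _ := by ring
  · have h1 : ∏ p ∈ (Finset.Icc 1 ⌊X⌋₊).filter Nat.Prime, (1 - (1 : ℝ) / p) =
        Real.exp (-mertensSum X) := by
      rw [mertensSum, ← sum_neg_distrib, Real.exp_sum]
      refine prod_congr rfl fun p hp ↦ ?_
      have := inv_prime_le_half (mem_filter.1 hp).2
      rw [neg_neg, Real.exp_log (by linarith), one_div]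
    rw [h1, show -mertensSum X = -Real.eulerMascheroniConstant + -Real.log (Real.log X) + -r by
      rw [hr]; ring, Real.exp_add, Real.exp_add, Real.exp_neg (Real.log (Real.log X)),
      Real.exp_log (by linarith)]
    ring
end

section
/- A positive integer n is a nilpotent number (i.e., every group of order n is nilpotent) if and only if gcd(n, φ̃(n)) = 1, where φ̃ is the multiplicative function with φ̃(p^a) = (p^a - 1)(p^{a-1} - 1)···(p - 1) on prime powers. -/
open Finset

/-- No prime power `p ^ i > 1` dividing `n` is congruent to `1` modulo a prime divisor of `n`. -/
def PrimePowNotModOne (n : ℕ) : Prop :=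
  ∀ p q i : ℕ, p.Prime → q.Prime → q ∣ n → i ≠ 0 → p ^ i ∣ n → ¬ q ∣ p ^ i - 1

theorem PrimePowNotModOne.of_dvd {m n : ℕ} (hn : PrimePowNotModOne n) (h : m ∣ n) :
    PrimePowNotModOne m :=
  fun p q i hp hq hqm hi hpm => hn p q i hp hq (hqm.trans h) hi (hpm.trans h)

theorem coprime_iff_primePowNotModOne (f : ℕ → ℕ) (hf1 : f 1 = 1)
    (hfmul : ∀ m k : ℕ, Nat.Coprime m k → f (m * k) = f m * f k)
    (hfpp : ∀ p a : ℕ, p.Prime → 1 ≤ a → f (p ^ a) = ∏ i ∈ Finset.Icc 1 a, (p ^ i - 1))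
    {n : ℕ} (hn : n ≠ 0) : Nat.Coprime n (f n) ↔ PrimePowNotModOne n := by
  have key : ∀ q : ℕ, q.Prime →
      (q ∣ f n ↔ ∃ p i : ℕ, p.Prime ∧ i ≠ 0 ∧ p ^ i ∣ n ∧ q ∣ p ^ i - 1) := by
    intro q hq
    rw [Nat.multiplicative_factorization f hfmul hf1 hn, Finsupp.prod,
      hq.prime.dvd_finsetProd_iff]
    constructor
    · rintro ⟨p, hp, hd⟩
      have hpp := Nat.prime_of_mem_primeFactors hp
      have h1 : 1 ≤ n.factorization p :=
        Nat.one_le_iff_ne_zero.mpr (Finsupp.mem_support_iff.mp hp)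
      rw [hfpp p _ hpp h1, hq.prime.dvd_finsetProd_iff] at hd
      obtain ⟨i, hi, hd⟩ := hd
      rw [Finset.mem_Icc] at hi
      exact ⟨p, i, hpp, by omega,
        (hpp.pow_dvd_iff_le_factorization hn).mpr hi.2, hd⟩
    · rintro ⟨p, i, hp, hi, hpn, hd⟩
      have hle := (hp.pow_dvd_iff_le_factorization hn).mp hpn
      refine ⟨p, Finsupp.mem_support_iff.mpr (by omega), ?_⟩
      rw [hfpp p _ hp (by omega), hq.prime.dvd_finsetProd_iff]
      exact ⟨i, Finset.mem_Icc.mpr ⟨by omega, hle⟩, hd⟩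
  constructor
  · intro h p q i hp hq hqn hi hpn hd
    exact Nat.not_coprime_of_dvd_of_dvd hq.one_lt hqn
      ((key q hq).mpr ⟨p, i, hp, hi, hpn, hd⟩) h
  · intro h
    refine Nat.Coprime.symm (Nat.coprime_of_dvd ?_)
    intro q hq hqf hqn
    obtain ⟨p, i, hp, hi, hpn, hd⟩ := (key q hq).mp hqf
    exact h p q i hp hq hqn hi hpn hd

section FiniteGroup

variable {G : Type*} [Group G]

open Subgroup

theorem IsPGroup.le_centralizer_of_normal [Finite G] {p q : ℕ} [hp : Fact p.Prime]
    [hq : Fact q.Prime] (hpq : p ≠ q) {P H : Subgroup G} [P.Normal] (hP : IsPGroup p P)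
    (hH : IsPGroup q H) (h : ∀ i, i ≠ 0 → p ^ i ∣ Nat.card P → ¬ q ∣ p ^ i - 1) :
    P ≤ centralizer H := by
  let _ : MulAction H P := MulAction.compHom P ((MulAut.conjNormal (H := P)).comp H.subtype)
  have hfix : MulAction.fixedPoints H P = ((centralizer (H : Set G)).subgroupOf P : Set P) := by
    ext x
    simp only [MulAction.mem_fixedPoints, SetLike.mem_coe, mem_subgroupOf, mem_centralizer_iff,
      Subtype.forall]
    refine forall₂_congr fun g hg => ?_
    rw [Subtype.ext_iff, ← mul_inv_eq_iff_eq_mul]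
    exact Iff.rfl
  have hmod := hH.card_modEq_card_fixedPoints P
  rw [hfix] at hmod
  change _ ≡ Nat.card ((centralizer (H : Set G)).subgroupOf P) [MOD q] at hmod
  obtain ⟨a, ha⟩ := IsPGroup.iff_card.mp hP
  obtain ⟨b, hb⟩ := IsPGroup.iff_card.mp (hP.to_subgroup ((centralizer (H : Set G)).subgroupOf P))
  have hba : b ≤ a := by
    have := Subgroup.card_subgroup_dvd_card ((centralizer (H : Set G)).subgroupOf P)
    rw [ha, hb] at this
    exact (Nat.pow_dvd_pow_iff_le_right hp.out.one_lt).mp this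
  rw [← subgroupOf_eq_top]
  apply Subgroup.eq_top_of_card_eq
  rw [ha, hb] at hmod
  rw [ha] at h ⊢
  rw [hb]
  have hd : q ∣ p ^ b * (p ^ (a - b) - 1) := by
    rw [Nat.mul_sub, ← pow_add, mul_one, Nat.add_sub_cancel' hba]
    exact (Nat.modEq_iff_dvd' (Nat.pow_le_pow_right hp.out.pos hba)).mp hmod.symm
  rcases hq.out.dvd_mul.mp hd with hd | hd
  · exact absurd ((Nat.prime_dvd_prime_iff_eq hq.out hp.out).mp (hq.out.dvd_of_dvd_pow hd)).symm hpq
  · by_contra hne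
    exact h (a - b) (fun h0 => hne (by rw [show a = b by omega]))
      (pow_dvd_pow p (Nat.sub_le a b)) hd

theorem Subgroup.eq_top_of_forall_sylow_le [Finite G] {H : Subgroup G}
    (h : ∀ (p : ℕ) (_ : Fact p.Prime), ∃ P : Sylow p G, (P : Subgroup G) ≤ H) : H = ⊤ := by
  by_contra hne
  obtain ⟨p, hp, hd⟩ := Nat.exists_prime_and_dvd (mt Subgroup.index_eq_one.mp hne)
  have := Fact.mk hp
  obtain ⟨P, hP⟩ := h p this
  exact P.not_dvd_index (hd.trans (index_dvd_of_le hP))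

theorem Sylow.normal_of_forall_ne_normal [Finite G] (hG : PrimePowNotModOne (Nat.card G))
    {p : ℕ} [hp : Fact p.Prime] (P : Sylow p G)
    (h : ∀ q, q ≠ p → ∀ _ : Fact q.Prime, ∀ Q : Sylow q G, (Q : Subgroup G).Normal) :
    (P : Subgroup G).Normal := by
  by_cases hpG : p ∣ Nat.card G
  · rw [← normalizer_eq_top_iff]
    apply eq_top_of_forall_sylow_le
    intro q hq
    by_cases hqp : q = p
    · subst hqp
      exact ⟨P, le_normalizer⟩
    · obtain ⟨Q⟩ : Nonempty (Sylow q G) := inferInstance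
      have := h q hqp hq Q
      refine ⟨Q, (Q.2.le_centralizer_of_normal hqp P.2 ?_).trans (centralizer_le_normalizer _)⟩
      exact fun i hi hd => hG q p i hq.out hp.out hpG hi (hd.trans (card_subgroup_dvd_card _))
  · have : (P : Subgroup G) = ⊥ := by
      rcases P.2.card_eq_or_dvd with h1 | h1
      · exact card_eq_one.mp h1
      · exact absurd (h1.trans (card_subgroup_dvd_card _)) hpG
    rw [this]
    infer_instance

theorem Sylow.normal_of_le_of_isNilpotent [Finite G] {M : Subgroup G} [M.Normal]
    [Group.IsNilpotent M] {p : ℕ} [Fact p.Prime] (P : Sylow p G) (hP : (P : Subgroup G) ≤ M) :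
    (P : Subgroup G).Normal := by
  have h1 : ((P.subtype hP : Sylow p M) : Subgroup M).Normal := inferInstance
  have h2 := (P.subtype hP).characteristic_of_normal h1
  have h3 : (((P.subtype hP : Sylow p M) : Subgroup M).map M.subtype).Normal := inferInstance
  rwa [Sylow.coe_subtype, map_subgroupOf_eq_of_le hP] at h3

/-- If the commutator subgroup is proper and all proper subgroups are nilpotent, then a group whose
order satisfies `PrimePowNotModOne` is nilpotent. -/
theorem isNilpotent_of_commutator_ne_top [Finite G] (hG : PrimePowNotModOne (Nat.card G))
    (hsub : ∀ H : Subgroup G, H ≠ ⊤ → Group.IsNilpotent H) (hc : commutator G ≠ ⊤) :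
    Group.IsNilpotent G := by
  obtain ⟨M, hM, hcM⟩ := (eq_top_or_exists_le_coatom (commutator G)).resolve_left hc
  have hMn : M.Normal := Subgroup.Normal.of_commutator_le G hcM
  have := hsub M hM.1
  refine (Group.isNilpotent_of_finite_tfae (G := G)).out 3 0 |>.mp ?_
  intro p hp P
  by_cases hPM : (P : Subgroup G) ≤ M
  · exact P.normal_of_le_of_isNilpotent hPM
  · refine P.normal_of_forall_ne_normal hG fun q hqp hq Q => ?_
    refine Q.normal_of_le_of_isNilpotent (M := M) ?_
    have htop : (P : Subgroup G) ⊔ M = ⊤ :=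
      hM.2 _ (lt_of_le_of_ne le_sup_right fun h => hPM (h ▸ le_sup_left))
    have hsurj : (P : Subgroup G).map (QuotientGroup.mk' M) = ⊤ := by
      have := congrArg (Subgroup.map (QuotientGroup.mk' M)) htop
      rwa [Subgroup.map_sup, QuotientGroup.map_mk'_self, sup_bot_eq,
        Subgroup.map_top_of_surjective _ (QuotientGroup.mk'_surjective M)] at this
    have h1 := P.2.map (QuotientGroup.mk' M)
    have h2 := Q.2.map (QuotientGroup.mk' M)
    have h3 := IsPGroup.disjoint_of_ne p q (Ne.symm hqp) _ _ h1 h2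
    rw [hsurj, top_disjoint, Subgroup.map_eq_bot_iff, QuotientGroup.ker_mk'] at h3
    exact h3

/-- In a finite group without nontrivial proper normal subgroups whose proper subgroups are all
nilpotent, distinct Sylow subgroups intersect trivially. -/
theorem Sylow.eq_of_inf_ne_bot [Finite G] (hs : ∀ N : Subgroup G, N.Normal → N = ⊥ ∨ N = ⊤)
    (hsub : ∀ H : Subgroup G, H ≠ ⊤ → Group.IsNilpotent H) {p : ℕ} [hp : Fact p.Prime]
    (P Q : Sylow p G) (hPQ : ((P : Subgroup G) ⊓ Q) ≠ ⊥) : P = Q := by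
  suffices ∀ (D : Subgroup G) (P Q : Sylow p G), D = ((P : Subgroup G) ⊓ Q) → D ≠ ⊥ → P = Q from
    this _ P Q rfl hPQ
  clear! P Q
  intro D
  induction D using WellFoundedGT.induction with
  | ind D ih =>
    intro P Q hD hbot
    by_contra hne
    have grow : ∀ R : Sylow p G, D ≤ R → D ≠ R → D < (R : Subgroup G) ⊓ normalizer (D : Set G) := by
      intro R hDR hDne
      have : Group.IsNilpotent R := R.2.isNilpotent
      refine lt_of_le_of_ne (le_inf hDR le_normalizer) fun heq => ?_
      have hlt := Group.normalizerCondition_of_isNilpotent (G := R) (D.subgroupOf R)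
        (lt_top_iff_ne_top.mpr fun h => hDne (le_antisymm hDR (subgroupOf_eq_top.mp h)))
      refine hlt.not_ge fun x hx => ?_
      rw [mem_subgroupOf, heq]
      refine ⟨x.2, mem_normalizer_iff.mpr fun y => ?_⟩
      rw [mem_normalizer_iff] at hx
      constructor
      · exact fun hy => (hx ⟨y, hDR hy⟩).mp hy
      · intro hy
        have hyR : y ∈ (R : Subgroup G) := by
          have := mul_mem (mul_mem (inv_mem x.2) (hDR hy)) x.2
          simpa [mul_assoc] using this
        exact (hx ⟨y, hyR⟩).mpr hy
    have hP : D < (P : Subgroup G) ⊓ normalizer (D : Set G) := by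
      refine grow P (hD ▸ inf_le_left) fun h => hne ?_
      exact Sylow.ext (P.3 Q.2 (h ▸ hD ▸ inf_le_right)).symm
    have hQ : D < (Q : Subgroup G) ⊓ normalizer (D : Set G) := by
      refine grow Q (hD ▸ inf_le_right) fun h => hne ?_
      exact Sylow.ext (Q.3 P.2 (h ▸ hD ▸ inf_le_left))
    have hN : normalizer (D : Set G) ≠ ⊤ := by
      intro h
      rcases hs D (normalizer_eq_top_iff.mp h) with h | h
      · exact hbot h
      · exact not_top_lt (h ▸ hP)
    have := hsub _ hN
    obtain ⟨T⟩ : Nonempty (Sylow p (normalizer (D : Set G))) := inferInstance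
    obtain ⟨R, hR⟩ := (T.2.map (normalizer (D : Set G)).subtype).exists_le_sylow
    have hle : ∀ S : Sylow p G, (S : Subgroup G) ⊓ normalizer (D : Set G) ≤ R := by
      intro S
      have h1 : IsPGroup p ((S : Subgroup G).subgroupOf (normalizer (D : Set G))) :=
        S.2.comap_subtype
      obtain ⟨T', hT'⟩ := h1.exists_le_sylow
      have hTT : T' = T := (Sylow.unique_of_normal T inferInstance).eq_default T' |>.trans
        ((Sylow.unique_of_normal T inferInstance).eq_default T).symm
      rw [hTT] at hT'
      refine le_trans ?_ hR
      rw [← subgroupOf_map_subtype]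
      exact map_mono hT'
    have e1 : P = R := ih _ (hP.trans_le (le_inf inf_le_left (hle P))) P R rfl
      (bot_lt_iff_ne_bot.mpr hbot |>.trans (hP.trans_le (le_inf inf_le_left (hle P)))).ne'
    have e2 : Q = R := ih _ (hQ.trans_le (le_inf inf_le_left (hle Q))) Q R rfl
      (bot_lt_iff_ne_bot.mpr hbot |>.trans (hQ.trans_le (le_inf inf_le_left (hle Q)))).ne'
    exact hne (e1.trans e2.symm)

/-- A subgroup with nilpotent normalizer is trivial if it equals its own commutator with the
normalizer. -/
theorem Subgroup.eq_bot_of_le_commutator {P N : Subgroup G} [hN : Group.IsNilpotent N]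
    (hPN : P ≤ N) (h : P ≤ ⁅P, N⁆) : P = ⊥ := by
  obtain ⟨n, hn⟩ := (isNilpotent_iff_lowerCentralSeries N).mp hN
  have : ∀ k, P ≤ N.lowerCentralSeries k := by
    intro k
    induction k with
    | zero => exact hPN
    | succ k ih => exact h.trans (commutator_mono ih le_rfl)
  exact le_bot_iff.mp (hn ▸ this n)

theorem commutator_ne_top_of_forall_normal [Finite G] [Nontrivial G]
    (hs : ∀ N : Subgroup G, N.Normal → N = ⊥ ∨ N = ⊤)
    (hsub : ∀ H : Subgroup G, H ≠ ⊤ → Group.IsNilpotent H) : commutator G ≠ ⊤ := by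
  obtain ⟨p, hp, hd⟩ := Nat.exists_prime_and_dvd (Finite.one_lt_card (α := G)).ne'
  have := Fact.mk hp
  obtain ⟨P⟩ : Nonempty (Sylow p G) := inferInstance
  have hPbot := P.ne_bot_of_dvd_card hd
  by_cases hPn : (P : Subgroup G).Normal
  · have hPtop := (hs P hPn).resolve_left hPbot
    have hG : IsPGroup p G := by
      have := P.2
      rw [hPtop] at this
      exact this.of_equiv topEquiv
    have : Group.IsNilpotent G := hG.isNilpotent
    exact (Group.IsSolvable.commutator_lt_top_of_nontrivial G).ne
  · intro htop
    have hN : normalizer ((P : Subgroup G) : Set G) ≠ ⊤ := mt normalizer_eq_top_iff.mp hPn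
    have := hsub _ hN
    have hfoc := commutator_inf_eq_focalSubgroup P
    rw [htop, top_inf_eq] at hfoc
    refine hPbot (eq_bot_of_le_commutator (N := normalizer ((P : Subgroup G) : Set G))
      le_normalizer ?_)
    conv_lhs => rw [hfoc]
    rw [focalSubgroup_def, closure_le]
    rintro g ⟨hg, x, hx, u, rfl⟩
    by_cases hx1 : x = 1
    · subst hx1
      simp
    refine commutator_mem_commutator hx ?_
    change u ∈ normalizer (P : Set G)
    rw [← Sylow.smul_eq_iff_mem_normalizer]
    refine Sylow.eq_of_inf_ne_bot hs hsub _ _ fun hbot => hx1 ?_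
    have hmem : u * x⁻¹ * u⁻¹ ∈ (((u • P : Sylow p G) : Subgroup G) ⊓ P : Subgroup G) := by
      constructor
      · rw [Sylow.coe_subgroup_smul]
        exact ⟨x⁻¹, inv_mem hx, by simp [mul_assoc]⟩
      · have := mul_mem (inv_mem hx) hg
        change _ ∈ (P : Subgroup G)
        simpa only [commutatorElement_def, mul_assoc, inv_mul_cancel_left] using this
    rw [hbot, mem_bot] at hmem
    simpa using hmem

end FiniteGroup

theorem isNilpotent_of_primePowNotModOne {n : ℕ} (hn : PrimePowNotModOne n)
    {G : Type*} [Group G] [Finite G] (hG : Nat.card G = n) : Group.IsNilpotent G := by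
  induction n using Nat.strong_induction_on generalizing G with
  | _ n ih =>
    subst hG
    have hsub : ∀ H : Subgroup G, H ≠ ⊤ → Group.IsNilpotent H := fun H hH =>
      ih _ (lt_of_le_of_ne (Subgroup.card_le_card_group H) (mt H.eq_top_of_card_eq hH))
        (hn.of_dvd H.card_subgroup_dvd_card) rfl
    rcases subsingleton_or_nontrivial G with hG | hG
    · infer_instance
    refine isNilpotent_of_commutator_ne_top hn hsub ?_
    by_cases hs : ∀ N : Subgroup G, N.Normal → N = ⊥ ∨ N = ⊤
    · exact commutator_ne_top_of_forall_normal hs hsub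
    · push Not at hs
      obtain ⟨N, hN, hbot, htop⟩ := hs
      have := hsub N htop
      have hlt : Nat.card (G ⧸ N) < Nat.card G := by
        rw [N.card_eq_card_quotient_mul_card_subgroup]
        exact lt_mul_of_one_lt_right Nat.card_pos (N.one_lt_card_iff_ne_bot.mpr hbot)
      have hq : Group.IsNilpotent (G ⧸ N) :=
        ih _ hlt (hn.of_dvd N.card_quotient_dvd_card) rfl
      have : Group.IsSolvable G := (Group.isSolvable_iff_subgroup_quotient N).mpr
        ⟨inferInstance, inferInstance⟩
      exact (Group.IsSolvable.commutator_lt_top_of_nontrivial G).ne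

theorem SemidirectProduct.center_eq_bot {N H : Type*} [CommGroup N] [Group H] {φ : H →* MulAut N}
    (hφ : Function.Injective φ) {h : H} (hfix : ∀ x, φ h x = x → x = 1) :
    Subgroup.center (N ⋊[φ] H) = ⊥ := by
  refine (Subgroup.eq_bot_iff_forall _).mpr fun z hz => ?_
  rw [Subgroup.mem_center_iff] at hz
  have hr : z.right = 1 := hφ <| by
    ext y
    have := congrArg SemidirectProduct.left (hz (inl y))
    simp only [mul_left, left_inl, right_inl, map_one, MulAut.one_apply] at this ⊢
    rw [mul_comm] at this
    exact (mul_left_cancel this).symm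
  have hl : z.left = 1 := hfix _ <| by
    simpa using congrArg SemidirectProduct.left (hz (inr h))
  exact SemidirectProduct.ext hl hr

theorem exists_card_eq_not_isNilpotent {p q i : ℕ} (hp : p.Prime) (hq : q.Prime) (hi : i ≠ 0)
    (hd : q ∣ p ^ i - 1) :
    ∃ (G : Type) (_ : Group G) (_ : Finite G), Nat.card G = p ^ i * q ∧
      ¬ Group.IsNilpotent G := by
  have := Fact.mk hp
  have := Fact.mk hq
  let K := GaloisField p i
  have hK : Nat.card K = p ^ i := GaloisField.card p i hi
  have : Finite K := Nat.finite_of_card_ne_zero (hK ▸ (pow_pos hp.pos i).ne')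
  have := Fintype.ofFinite K
  obtain ⟨u, hu⟩ := exists_prime_orderOf_dvd_card' (G := Kˣ) q (by rwa [Nat.card_units, hK])
  let φ : Subgroup.zpowers u →* MulAut (Multiplicative K) :=
    ((MulAutMultiplicative K).symm.toMonoidHom.comp (DistribMulAction.toAddAut Kˣ K)).comp
      (Subgroup.zpowers u).subtype
  have happ (v : Subgroup.zpowers u) (x : Multiplicative K) :
      φ v x = Multiplicative.ofAdd (((v : Kˣ) : K) * x.toAdd) := rfl
  have hφ : Function.Injective φ := fun v w hvw => by
    have := DFunLike.congr_fun hvw (Multiplicative.ofAdd (1 : K))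
    rw [happ, happ] at this
    exact Subtype.ext (Units.ext (by
      simpa only [toAdd_ofAdd, mul_one] using Multiplicative.ofAdd.injective this))
  refine ⟨Multiplicative K ⋊[φ] Subgroup.zpowers u, inferInstance,
    Finite.of_equiv _ SemidirectProduct.equivProd.symm, ?_, fun hnil => ?_⟩
  · rw [SemidirectProduct.card, Nat.card_zpowers, hu, Nat.card_congr Multiplicative.toAdd, hK]
  · have : Nontrivial (Multiplicative K ⋊[φ] Subgroup.zpowers u) :=
      SemidirectProduct.inl_injective.nontrivial
    refine Group.IsNilpotent.center_ne_bot _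
      (SemidirectProduct.center_eq_bot hφ (h := ⟨u, Subgroup.mem_zpowers u⟩) fun x hx => ?_)
    rw [happ] at hx
    have hx : (u : K) * x.toAdd = x.toAdd := hx
    by_contra hne
    have h1 : (u : K) = 1 := (mul_eq_right₀ (show x.toAdd ≠ 0 from hne)).mp hx
    rw [Units.val_eq_one] at h1
    exact hq.one_lt.ne (by rw [← hu, h1, orderOf_one])

theorem primePowNotModOne_of_forall_isNilpotent {n : ℕ} (hn : n ≠ 0)
    (h : ∀ (G : Type) [Group G] [Fintype G], Fintype.card G = n → Group.IsNilpotent G) :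
    PrimePowNotModOne n := by
  intro p q i hp hq hqn hi hpn hd
  obtain ⟨G, _, _, hcard, hG⟩ := exists_card_eq_not_isNilpotent hp hq hi hd
  have hcop : Nat.Coprime (p ^ i) q :=
    (Nat.Coprime.coprime_dvd_right hd
      ((Nat.coprime_self_sub_right (Nat.one_le_pow _ _ hp.pos)).mpr (Nat.coprime_one_right _)))
  obtain ⟨m, rfl⟩ := hcop.mul_dvd_of_dvd_of_dvd hpn hqn
  have : NeZero m := ⟨right_ne_zero_of_mul hn⟩
  have := Fintype.ofFinite (G × Multiplicative (ZMod m))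
  have := h (G × Multiplicative (ZMod m)) (by
    rw [← Nat.card_eq_fintype_card, Nat.card_prod, hcard, Nat.card_congr Multiplicative.toAdd,
      Nat.card_zmod])
  exact hG (Group.nilpotent_of_surjective (MonoidHom.fst G (Multiplicative (ZMod m)))
    Prod.fst_surjective)

/-- A positive integer `n` is a nilpotent number (every group of order `n` is nilpotent)
iff `gcd(n, φ̃(n)) = 1`, where `φ̃` is the multiplicative function with
`φ̃(p^a) = ∏_{i=1}^a (p^i - 1)`. -/
theorem nilpotent_number_iff_coprime (f : ℕ → ℕ)
    (hf1 : f 1 = 1)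
    (hfmul : ∀ m k : ℕ, Nat.Coprime m k → f (m * k) = f m * f k)
    (hfpp : ∀ p a : ℕ, p.Prime → 1 ≤ a → f (p ^ a) = ∏ i ∈ Finset.Icc 1 a, (p ^ i - 1))
    (n : ℕ) (hn : 0 < n) :
    (∀ (G : Type) [Group G] [Fintype G], Fintype.card G = n → Group.IsNilpotent G) ↔
      Nat.Coprime n (f n) := by
  rw [coprime_iff_primePowNotModOne f hf1 hfmul hfpp hn.ne']
  refine ⟨primePowNotModOne_of_forall_isNilpotent hn.ne', fun h G _ _ hG => ?_⟩
  exact isNilpotent_of_primePowNotModOne h (Nat.card_eq_fintype_card.trans hG)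
end

section
/- A positive integer n is an abelian number (i.e., every group of order n is abelian) if and only if n is cubefree and gcd(n, φ̃(n)) = 1, where φ̃ is the multiplicative function with φ̃(p^a) = (p^a − 1)(p^{a−1} − 1)···(p − 1). -/
open Finset

/-- A nontrivial unit `u` of a finite ring `R` acts nontrivially on the additive group of `R`; the
resulting semidirect product shows that multiples of `|R| * orderOf u` are not abelian numbers. -/
theorem exists_noncommutative_group_of_unit (R : Type) [Ring R] [Finite R] (u : Rˣ) (hu : u ≠ 1)
    {n : ℕ} (hn : 0 < n) (h : Nat.card R * orderOf u ∣ n) :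
    ∃ (G : Type) (_ : Group G) (_ : Fintype G), Fintype.card G = n ∧ ∃ a b : G, a * b ≠ b * a := by
  obtain ⟨m, rfl⟩ := h
  have : NeZero m := ⟨by rintro rfl; simp at hn⟩
  let φ : Subgroup.zpowers u →* MulAut (Multiplicative R) :=
    ((MulAutMultiplicative R).symm.toMonoidHom.comp (DistribMulAction.toAddAut Rˣ R)).comp
      (Subgroup.zpowers u).subtype
  let S := Multiplicative R ⋊[φ] Subgroup.zpowers u
  have : Finite S := Finite.of_equiv _ SemidirectProduct.equivProd.symm
  let inst : Fintype (S × Multiplicative (ZMod m)) := Fintype.ofFinite _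
  refine ⟨S × Multiplicative (ZMod m), inferInstance, inst, ?_,
    (SemidirectProduct.inr ⟨u, Subgroup.mem_zpowers u⟩, 1),
    (SemidirectProduct.inl (Multiplicative.ofAdd 1), 1), fun hab => ?_⟩
  · rw [← Nat.card_eq_fintype_card, Nat.card_prod, SemidirectProduct.card, Nat.card_zpowers,
      Nat.card_congr Multiplicative.toAdd, Nat.card_congr Multiplicative.toAdd, Nat.card_zmod]
  · have key := congrArg (fun x => Multiplicative.toAdd x.1.left) hab
    rw [Prod.mk_mul_mk, Prod.mk_mul_mk, SemidirectProduct.mul_left, SemidirectProduct.mul_left,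
      SemidirectProduct.left_inr, SemidirectProduct.right_inr, SemidirectProduct.left_inl,
      SemidirectProduct.right_inl] at key
    refine hu (Units.ext ?_)
    simpa [φ, Units.smul_def] using key

theorem exists_noncommutative_group_of_cube_dvd {p n : ℕ} (hp : p.Prime) (hn : 0 < n)
    (h : p ^ 3 ∣ n) :
    ∃ (G : Type) (_ : Group G) (_ : Fintype G), Fintype.card G = n ∧ ∃ a b : G, a * b ≠ b * a := by
  have : Fact p.Prime := ⟨hp⟩
  let R := DualNumber (ZMod p)
  have : Finite R := inferInstanceAs (Finite (ZMod p × ZMod p))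
  have : CharP R p := charP_of_injective_algebraMap (algebraMap (ZMod p) R).injective p
  have hcard : Nat.card R = p ^ 2 := by
    rw [show Nat.card R = Nat.card (ZMod p × ZMod p) from rfl]
    simp [sq]
  have hpow : (1 + DualNumber.eps : R) ^ p = 1 := by
    rw [add_pow_char, one_pow, pow_eq_zero_of_le hp.two_le, add_zero]
    rw [sq, DualNumber.eps_mul_eps]
  let u : Rˣ := Units.ofPowEqOne _ p hpow hp.ne_zero
  have hu : u ≠ 1 := fun h1 => by
    have h2 := congrArg (fun x : Rˣ => TrivSqZeroExt.snd (x : R)) h1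
    rw [show (u : R) = 1 + DualNumber.eps from rfl, TrivSqZeroExt.snd_add] at h2
    simp at h2
  refine exists_noncommutative_group_of_unit R u hu hn ?_
  rw [orderOf_eq_prime (Units.pow_ofPowEqOne hpow hp.ne_zero) hu, hcard, ← pow_succ]
  exact h

theorem exists_noncommutative_group_of_dvd_pow_sub_one {p q i n : ℕ} (hp : p.Prime) (hq : q.Prime)
    (hi : i ≠ 0) (hn : 0 < n) (hpn : p ^ i ∣ n) (hqn : q ∣ n) (hqp : q ∣ p ^ i - 1) :
    ∃ (G : Type) (_ : Group G) (_ : Fintype G), Fintype.card G = n ∧ ∃ a b : G, a * b ≠ b * a := by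
  have : Fact p.Prime := ⟨hp⟩
  have : Fact q.Prime := ⟨hq⟩
  have hcard := GaloisField.card p i hi
  obtain ⟨u, hu⟩ := exists_prime_orderOf_dvd_card' (G := (GaloisField p i)ˣ) q
    (by rwa [Nat.card_units, hcard])
  refine exists_noncommutative_group_of_unit (GaloisField p i) u ?_ hn ?_
  · rintro rfl
    exact hq.one_lt.ne (by simpa using hu)
  · rw [hcard, hu]
    refine Nat.Coprime.mul_dvd_of_dvd_of_dvd ?_ hpn hqn
    refine Nat.Coprime.coprime_dvd_right hqp ?_
    have := Nat.coprime_self_sub_right (Nat.one_le_pow i p hp.pos)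
    exact this.2 (Nat.coprime_one_right _)

/-- An automorphism of prime order `q ≠ p` of a group of order `p ^ a` has `p ^ b` fixed points
for some `b < a`, so that `q` divides `p ^ (a - b) - 1`. -/
theorem exists_dvd_pow_sub_one_of_orderOf_mulAut {P : Type*} [Group P] [Finite P] {p q a : ℕ}
    (hp : p.Prime) (hq : q.Prime) (hqp : q ≠ p) (hP : Nat.card P = p ^ a) (x : MulAut P)
    (hx : orderOf x = q) : ∃ i ∈ Finset.Icc 1 a, q ∣ p ^ i - 1 := by
  have : Fact q.Prime := ⟨hq⟩
  have hmod := (IsPGroup.of_card (n := 1) (by rw [Nat.card_zpowers, hx, pow_one]) :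
    IsPGroup q (Subgroup.zpowers x)).card_modEq_card_fixedPoints P
  let F : Subgroup P := FixedPoints.subgroup (Subgroup.zpowers x) P
  obtain ⟨b, hb, hF⟩ := (Nat.dvd_prime_pow hp).1 (hP ▸ F.card_subgroup_dvd_card)
  have hlt : b < a := by
    refine hb.lt_of_ne ?_
    rintro rfl
    have htop : F = ⊤ := F.eq_top_of_card_eq (hF.trans hP.symm)
    have hx1 : x = 1 := by
      ext y
      have hy : y ∈ F := htop ▸ Subgroup.mem_top y
      exact hy ⟨x, Subgroup.mem_zpowers x⟩
    rw [hx1, orderOf_one] at hx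
    exact hq.one_lt.ne hx
  refine ⟨a - b, Finset.mem_Icc.2 ⟨by omega, by omega⟩, ?_⟩
  rw [hP, show Nat.card (MulAction.fixedPoints (Subgroup.zpowers x) P) = p ^ b from hF] at hmod
  have hdvd := (Nat.modEq_iff_dvd' (Nat.pow_le_pow_right hp.pos hb)).1 hmod.symm
  have hfac : p ^ a - p ^ b = p ^ b * (p ^ (a - b) - 1) := by
    rw [Nat.mul_sub, ← pow_add, Nat.add_sub_cancel' hb, mul_one]
  rw [hfac] at hdvd
  exact (Nat.Coprime.pow_right b ((Nat.coprime_primes hq hp).2 hqp)).dvd_of_dvd_mul_left hdvd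

theorem Sylow.normalizer_le_centralizer_of_not_dvd_pow_sub_one {G : Type*} [Group G] [Finite G]
    {p : ℕ} [hp : Fact p.Prime] (P : Sylow p G) (hcomm : ∀ a b : P, a * b = b * a)
    (h : ∀ q : ℕ, q.Prime → q ∣ Nat.card G →
      ∀ i ∈ Finset.Icc 1 ((Nat.card G).factorization p), ¬ q ∣ p ^ i - 1) :
    Subgroup.normalizer (P : Set G) ≤ Subgroup.centralizer (P : Set G) := by
  have hPC : (P : Subgroup G) ≤ Subgroup.centralizer (P : Set G) := fun a ha b hb =>
    congrArg Subtype.val (hcomm ⟨b, hb⟩ ⟨a, ha⟩)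
  let φ := (P : Subgroup G).normalizerMonoidHom
  have hcard : Nat.card φ.range =
      (Subgroup.centralizer (P : Set G)).relIndex (Subgroup.normalizer (P : Set G)) := by
    rw [← Subgroup.index_ker, Subgroup.normalizerMonoidHom_ker]
    rfl
  rw [← Subgroup.relIndex_eq_one, ← hcard]
  by_contra hne
  obtain ⟨q, hq, hqd⟩ := Nat.exists_prime_and_dvd hne
  have : Fact q.Prime := ⟨hq⟩
  have hqp : q ≠ p := by
    rintro rfl
    refine P.not_dvd_index (hqd.trans (hcard ▸ ?_))
    exact (Subgroup.relIndex_dvd_of_le_left _ hPC).trans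
      (Subgroup.relIndex_dvd_index_of_le Subgroup.le_normalizer)
  have hqG : q ∣ Nat.card G := by
    rw [hcard] at hqd
    exact (hqd.trans (Subgroup.relIndex_dvd_card _ _)).trans (Subgroup.card_subgroup_dvd_card _)
  obtain ⟨x, hx⟩ := exists_prime_orderOf_dvd_card' q hqd
  obtain ⟨i, hi, hdvd⟩ := exists_dvd_pow_sub_one_of_orderOf_mulAut hp.out hq hqp
    P.card_eq_multiplicity (x : MulAut P) (by rw [Subgroup.orderOf_coe, hx])
  exact h q hq hqG i hi hdvd

theorem commute_of_forall_sylow_normalizer_le_centralizer {G : Type*} [Group G] [Finite G]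
    (h : ∀ (p : ℕ) [Fact p.Prime] (P : Sylow p G),
      Subgroup.normalizer (P : Set G) ≤ Subgroup.centralizer (P : Set G)) (a b : G) :
    a * b = b * a := by
  have hcard : Nat.card (commutator G) = 1 := by
    by_contra hne
    obtain ⟨p, hp, hdvd⟩ := Nat.exists_prime_and_dvd hne
    have : Fact p.Prime := ⟨hp⟩
    let P : Sylow p G := default
    refine MonoidHom.not_dvd_card_ker_transferSylow P (h p P)
      (hdvd.trans (Subgroup.card_dvd_of_le ?_))
    have hcomm : ∀ x y : P, x * y = y * x := fun x y =>
      Subtype.ext (h p P (Subgroup.le_normalizer y.2) x x.2)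
    rw [commutator_def, Subgroup.commutator_le]
    intro x _ y _
    rw [MonoidHom.mem_ker, map_commutatorElement, commutatorElement_eq_one_iff_mul_comm]
    exact hcomm _ _
  have hmem := Subgroup.commutator_mem_commutator (Subgroup.mem_top a) (Subgroup.mem_top b)
  rw [← commutator_def, Subgroup.card_eq_one.1 hcard, Subgroup.mem_bot] at hmem
  exact commutatorElement_eq_one_iff_mul_comm.1 hmem

theorem commute_of_card_eq_prime_pow_of_lt_three {P : Type*} [Group P] {p a : ℕ}
    [hp : Fact p.Prime] (hP : Nat.card P = p ^ a) (ha : a < 3) (x y : P) : x * y = y * x := by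
  interval_cases a
  · have := (Nat.card_eq_one_iff_unique.1 (hP.trans (pow_zero p))).1
    exact Subsingleton.elim _ _
  · have := isCyclic_of_prime_card (hP.trans (pow_one p))
    exact IsMulCommutative.is_comm.comm x y
  · exact (IsPGroup.isMulCommutative_of_card_eq_prime_sq hP).is_comm.comm x y

/-- The prime divisors of `φ̃(n)`. -/
theorem prime_dvd_iff_exists_dvd_pow_sub_one {f : ℕ → ℕ} (hf1 : f 1 = 1)
    (hfmul : ∀ m k : ℕ, Nat.Coprime m k → f (m * k) = f m * f k)
    (hfpp : ∀ p a : ℕ, p.Prime → 1 ≤ a → f (p ^ a) = ∏ i ∈ Finset.Icc 1 a, (p ^ i - 1))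
    {n : ℕ} (hn : n ≠ 0) {q : ℕ} (hq : q.Prime) :
    q ∣ f n ↔ ∃ p : ℕ, p.Prime ∧ ∃ i ∈ Finset.Icc 1 (n.factorization p), q ∣ p ^ i - 1 := by
  rw [Nat.multiplicative_factorization f hfmul hf1 hn, Finsupp.prod, hq.prime.dvd_finsetProd_iff]
  constructor
  · rintro ⟨p, hp, hd⟩
    have hpp := Nat.prime_of_mem_primeFactors hp
    rw [hfpp p _ hpp (Nat.one_le_iff_ne_zero.2 (Finsupp.mem_support_iff.1 hp)),
      hq.prime.dvd_finsetProd_iff] at hd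
    exact ⟨p, hpp, hd⟩
  · rintro ⟨p, hp, i, hi, hd⟩
    have h1 : 1 ≤ n.factorization p := (Finset.mem_Icc.1 hi).1.trans (Finset.mem_Icc.1 hi).2
    refine ⟨p, Finsupp.mem_support_iff.2 (by omega), ?_⟩
    rw [hfpp p _ hp h1]
    exact hd.trans (Finset.dvd_prod_of_mem (fun i => p ^ i - 1) hi)

/-- A positive integer `n` is an abelian number (every group of order `n` is abelian)
iff `n` is cubefree and `gcd(n, φ̃(n)) = 1`, where `φ̃` is the multiplicative function
with `φ̃(p^a) = ∏_{i=1}^a (p^i - 1)`. -/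
theorem abelian_number_iff_cubefree_coprime (f : ℕ → ℕ)
    (hf1 : f 1 = 1)
    (hfmul : ∀ m k : ℕ, Nat.Coprime m k → f (m * k) = f m * f k)
    (hfpp : ∀ p a : ℕ, p.Prime → 1 ≤ a → f (p ^ a) = ∏ i ∈ Finset.Icc 1 a, (p ^ i - 1))
    (n : ℕ) (hn : 0 < n) :
    (∀ (G : Type) [Group G] [Fintype G], Fintype.card G = n → ∀ a b : G, a * b = b * a) ↔
      ((∀ p : ℕ, p.Prime → ¬ p ^ 3 ∣ n) ∧ Nat.Coprime n (f n)) := by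
  constructor
  · intro h
    have hcontra : ¬ ∃ (G : Type) (_ : Group G) (_ : Fintype G),
        Fintype.card G = n ∧ ∃ a b : G, a * b ≠ b * a := by
      rintro ⟨G, _, _, hG, a, b, hab⟩
      exact hab (h G hG a b)
    refine ⟨fun p hp hd => hcontra (exists_noncommutative_group_of_cube_dvd hp hn hd),
      Nat.coprime_of_dvd fun q hq hqn hqf => hcontra ?_⟩
    obtain ⟨p, hp, i, hi, hd⟩ :=
      (prime_dvd_iff_exists_dvd_pow_sub_one hf1 hfmul hfpp hn.ne' hq).1 hqf
    rw [Finset.mem_Icc] at hi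
    exact exists_noncommutative_group_of_dvd_pow_sub_one hp hq (by omega) hn
      ((hp.pow_dvd_iff_le_factorization hn.ne').2 hi.2) hqn hd
  · rintro ⟨hcube, hcop⟩ G _ _ hG a b
    rw [← Nat.card_eq_fintype_card] at hG
    refine commute_of_forall_sylow_normalizer_le_centralizer (fun p hp P => ?_) a b
    refine P.normalizer_le_centralizer_of_not_dvd_pow_sub_one
      (commute_of_card_eq_prime_pow_of_lt_three P.card_eq_multiplicity ?_) ?_
    · rw [hG]
      by_contra! hle
      exact hcube p hp.out ((hp.out.pow_dvd_iff_le_factorization hn.ne').2 hle)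
    · rw [hG]
      intro q hq hqn i hi hd
      exact Nat.not_coprime_of_dvd_of_dvd hq.one_lt hqn
        ((prime_dvd_iff_exists_dvd_pow_sub_one hf1 hfmul hfpp hn.ne' hq).2
          ⟨p, hp.out, i, hi, hd⟩) hcop
end
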